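/- arXiv:2006.04447 — 2 statements merged into one kernel-verified Lean document; each statement's English description precedes it below -/
import Mathlib

section
/- Let f : 𝔸 → 𝔸 be a positive twist map that preserves the Lebesgue measure Leb, and let U ⊆ 𝔸 be an open set of finite Lebesgue measure which is f-periodic (f^M(U) = U for some M ∈ ℕ*). Then the following are equivalent: (i) for every z ∈ U the asymptotic torsion Torsion(f,z) exists and equals 0; (ii) for Leb-almost every z ∈ U the asymptotic torsion Torsion(f,z) exists and equals 0; (iii) no point z ∈ U has over-conjugate points. -/
noncomputable section

open MeasureTheory Set Filter Topology Function

/-- The annulus `𝔸 = (ℝ/ℤ) × ℝ`. -/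
abbrev Ann : Type := AddCircle (1 : ℝ) × ℝ

/-- The plane `ℝ²`, universal cover of the annulus. -/
abbrev Pl : Type := ℝ × ℝ

/-- The covering projection `π : ℝ² → 𝔸`, `π(x,y) = (x + ℤ, y)`. -/
def pr : Pl → Ann := fun p => ((p.1 : AddCircle (1 : ℝ)), p.2)

/-- The vertical vector `v = (0,1)`. -/
def vv : Pl := (0, 1)

/-- Data of a `C¹` diffeomorphism `f` of the annulus, isotopic to the identity,
presented through a lifted isotopy `(Ft t)_{t ∈ [0,1]}` of `C¹` diffeomorphisms of the
plane commuting with the deck transformation, with `Ft 0 = id` and `Ft 1` a lift of `f`,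
whose derivatives depend continuously on `(t, z)`. -/
structure IsotopySetup where
  f : Ann → Ann
  Ft : ℝ → Pl → Pl
  lift_f : ∀ p, pr (Ft 1 p) = f (pr p)
  Ft_zero : Ft 0 = id
  Ft_periodic : ∀ t, ∀ p : Pl, Ft t (p + (1, 0)) = Ft t p + (1, 0)
  Ft_smooth : ∀ t ∈ Icc (0:ℝ) 1, ContDiff ℝ 1 (Ft t)
  Ft_diffeo : ∀ t ∈ Icc (0:ℝ) 1, ∃ G : Pl → Pl, ContDiff ℝ 1 G ∧
      Function.LeftInverse G (Ft t) ∧ Function.RightInverse G (Ft t)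
  Ft_cont : ContinuousOn (fun q : ℝ × Pl => Ft q.1 q.2) (Icc (0:ℝ) 1 ×ˢ univ)
  DFt_cont : ContinuousOn (fun q : ℝ × Pl => fderiv ℝ (Ft q.1) q.2) (Icc (0:ℝ) 1 ×ˢ univ)

namespace IsotopySetup

variable (S : IsotopySetup)

/-- The canonical lift `F : ℝ² → ℝ²` of `f`. -/
def F : Pl → Pl := S.Ft 1

/-- The extended linearized isotopy: for `t ≥ 0`, `D t p` is the derivative at `p` of the
extended isotopy `f_t`, determined by `Df_{n+s} = Df_s ∘ Df^n` for `n ∈ ℕ`, `s ∈ [0,1)`. -/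
def D (t : ℝ) (p : Pl) : Pl →L[ℝ] Pl :=
  (fderiv ℝ (S.Ft (Int.fract t)) (S.F^[⌊t⌋₊] p)).comp (fderiv ℝ (S.F^[⌊t⌋₊]) p)

/-- `S.AngleVar p w n a` : the total angular variation on `[0,n]` of the vector `w ∈ T_{π(p)}𝔸`
under the extended linearized isotopy equals `a`; that is, `a = n·Torsionₙ(f, π(p), w)`.
Here `Θ` is a continuous lift of the angle `≺(v, Df_t(z)w)` (so that the direction of
`Df_t(z)w` is `(−sin(2πΘ(t)), cos(2πΘ(t)))`). -/
def AngleVar (p w : Pl) (n : ℕ) (a : ℝ) : Prop :=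
  ∃ Θ : ℝ → ℝ, ContinuousOn Θ (Icc 0 (n:ℝ)) ∧
    (∀ t ∈ Icc (0:ℝ) (n:ℝ), ∃ r : ℝ, 0 < r ∧
      S.D t p w = r • (-Real.sin (2 * Real.pi * Θ t), Real.cos (2 * Real.pi * Θ t))) ∧
    a = Θ n - Θ 0

/-- `S.TorsionFin p w n τ` : the finite-time torsion `Torsionₙ(f, π(p), w)` equals `τ`. -/
def TorsionFin (p w : Pl) (n : ℕ) (τ : ℝ) : Prop :=
  ∃ a : ℝ, S.AngleVar p w n a ∧ τ = a / n

/-- The asymptotic torsion at the lifted point `p` exists and equals `L`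
(for every choice of nonzero tangent vector `w`). -/
def TorsionLift (p : Pl) (L : ℝ) : Prop :=
  ∀ w : Pl, w ≠ 0 → ∃ a : ℕ → ℝ, (∀ n : ℕ, 1 ≤ n → S.AngleVar p w n (a n)) ∧
    Tendsto (fun n : ℕ => a n / (n : ℝ)) atTop (nhds L)

/-- The asymptotic torsion at `z ∈ 𝔸` exists and equals `L`. -/
def Torsion (z : Ann) (L : ℝ) : Prop :=
  ∃ p : Pl, pr p = z ∧ S.TorsionLift p L

open Classical in
/-- The asymptotic torsion as a function on the annulus (defaulting to `0` where undefined). -/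
def torsionFun (z : Ann) : ℝ :=
  if h : ∃ L, S.Torsion z L then h.choose else 0

/-- The lifted point `p` has conjugate points: `n·Torsionₙ(f,z,v) = −k/2` for some `n,k ≥ 1`. -/
def ConjLift (p : Pl) : Prop :=
  ∃ n k : ℕ, 1 ≤ n ∧ 1 ≤ k ∧ ∃ a : ℝ, S.AngleVar p vv n a ∧ a = -(k : ℝ) / 2

/-- The lifted point `p` has over-conjugate points: `n·Torsionₙ(f,z,v) < −1/2` for some `n ≥ 1`. -/
def OverConjLift (p : Pl) : Prop :=
  ∃ n : ℕ, 1 ≤ n ∧ ∃ a : ℝ, S.AngleVar p vv n a ∧ a < -(1:ℝ) / 2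

/-- The point `z ∈ 𝔸` has conjugate points. -/
def Conj (z : Ann) : Prop := ∃ p : Pl, pr p = z ∧ S.ConjLift p

/-- The point `z ∈ 𝔸` has over-conjugate points. -/
def OverConj (z : Ann) : Prop := ∃ p : Pl, pr p = z ∧ S.OverConjLift p

/-- `f` is a positive twist map: for every `x`, the map `y ↦ p₁(F(x,y))` is an increasing
diffeomorphism of `ℝ` onto `ℝ`. -/
def PosTwist : Prop :=
  ∀ x : ℝ, StrictMono (fun y => (S.F (x, y)).1) ∧
    Function.Surjective (fun y => (S.F (x, y)).1) ∧
    ∀ y : ℝ, 0 < deriv (fun y => (S.F (x, y)).1) y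

/-- `f` has no conjugate points (linearized-dynamics formulation): for every `z ∈ ℝ²` and
`n ≥ 1`, the first component of `DFⁿ(z)(0,1)` does not vanish. -/
def NoConjPts : Prop :=
  ∀ p : Pl, ∀ n : ℕ, 1 ≤ n → ((fderiv ℝ (S.F^[n]) p) (0, 1)).1 ≠ 0

/-- `f` is exact symplectic: it preserves the Lebesgue measure and `F*(y dx) − y dx = dS`
for a `C¹` function `S : ℝ² → ℝ` with `S(x+1,y) = S(x,y)`. -/
def ExactSymplectic : Prop :=
  MeasurePreserving S.f volume volume ∧
  ∃ Sg : Pl → ℝ, ContDiff ℝ 1 Sg ∧ (∀ p : Pl, Sg (p + (1, 0)) = Sg p) ∧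
    ∀ p : Pl,
      fderiv ℝ Sg p (1, 0) = (S.F p).2 * (fderiv ℝ S.F p (1, 0)).1 - p.2 ∧
      fderiv ℝ Sg p (0, 1) = (S.F p).2 * (fderiv ℝ S.F p (0, 1)).1

end IsotopySetup

/-- `γ` is an essential curve of the annulus: a topological embedding of the circle which is
not homotopic to a constant map. -/
def EssentialCurve (γ : C(AddCircle (1:ℝ), Ann)) : Prop :=
  Topology.IsEmbedding γ ∧ ∀ z : Ann, ¬ γ.Homotopic (ContinuousMap.const _ z)

/-- An open subset of the annulus is essential if it contains an essential curve. -/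
def EssentialSet (U : Set Ann) : Prop :=
  ∃ γ : C(AddCircle (1:ℝ), Ann), EssentialCurve γ ∧ range γ ⊆ U

/-- `f` restricted to `U` is `C⁰`-integrable: `U` is the disjoint union of a family of
`f`-invariant images of essential curves. -/
def C0IntegrableOn (f : Ann → Ann) (U : Set Ann) : Prop :=
  ∃ (ι : Type) (γ : ι → C(AddCircle (1:ℝ), Ann)),
    (∀ i, EssentialCurve (γ i) ∧ f '' range (γ i) = range (γ i)) ∧
    (⋃ i, range (γ i)) = U ∧
    Pairwise (Disjoint on fun i => range (γ i))

/-- `ℤ`-iterates of a bijection (negative iterates through the inverse map). -/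
def iterZ {α : Type*} [Nonempty α] (f : α → α) : ℤ → α → α
  | Int.ofNat n => f^[n]
  | Int.negSucc n => (Function.invFun f)^[n + 1]

/-- `ℐ(f)`: the union of all `f`-invariant essential curves. -/
def invCurveUnion (f : Ann → Ann) : Set Ann :=
  ⋃ γ ∈ {γ : C(AddCircle (1:ℝ), Ann) | EssentialCurve γ ∧ f '' range γ = range γ}, range γ



/-- unit vector of angle `θ` (in turns, from the vertical). -/
def uu (θ : ℝ) : Pl := (-Real.sin (2 * Real.pi * θ), Real.cos (2 * Real.pi * θ))

theorem continuous_uu : Continuous uu := by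
  unfold uu; fun_prop

theorem uu_ne (θ : ℝ) : uu θ ≠ 0 := by
  intro h
  have h1 : -Real.sin (2 * Real.pi * θ) = 0 := congrArg Prod.fst h
  have h2 : Real.cos (2 * Real.pi * θ) = 0 := congrArg Prod.snd h
  nlinarith [Real.sin_sq_add_cos_sq (2 * Real.pi * θ)]

theorem uu_add_half (θ : ℝ) : uu (θ + 1 / 2) = - uu θ := by
  have : 2 * Real.pi * (θ + 1 / 2) = 2 * Real.pi * θ + Real.pi := by ring
  unfold uu
  rw [this, Real.sin_add_pi, Real.cos_add_pi]
  simp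

theorem uu_zero : uu 0 = vv := by simp [uu, vv]

theorem uu_quarter : uu (-1 / 4) = (1, 0) := by
  have : 2 * Real.pi * (-1 / 4) = - (Real.pi / 2) := by ring
  simp [uu, this]

theorem uu_eq_imp {r s a b : ℝ} (hr : 0 < r) (hs : 0 < s) (h : r • uu a = s • uu b) :
    ∃ k : ℤ, a - b = k := by
  have h1 : r * -Real.sin (2 * Real.pi * a) = s * -Real.sin (2 * Real.pi * b) :=
    congrArg Prod.fst h
  have h2 : r * Real.cos (2 * Real.pi * a) = s * Real.cos (2 * Real.pi * b) :=
    congrArg Prod.snd h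
  have e1 := Real.sin_sq_add_cos_sq (2 * Real.pi * a)
  have e2 := Real.sin_sq_add_cos_sq (2 * Real.pi * b)
  have hsq : r ^ 2 = s ^ 2 := by
    have : r ^ 2 * (Real.sin (2 * Real.pi * a) ^ 2 + Real.cos (2 * Real.pi * a) ^ 2)
      = s ^ 2 * (Real.sin (2 * Real.pi * b) ^ 2 + Real.cos (2 * Real.pi * b) ^ 2) := by
      linear_combination (r * -Real.sin (2 * Real.pi * a) + s * -Real.sin (2 * Real.pi * b)) * h1
        + (r * Real.cos (2 * Real.pi * a) + s * Real.cos (2 * Real.pi * b)) * h2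
    rwa [e1, e2, mul_one, mul_one] at this
  have hrs : r = s := by
    rcases sq_eq_sq_iff_eq_or_eq_neg.mp hsq with h | h
    · exact h
    · linarith
  subst hrs
  have c1 : Real.sin (2 * Real.pi * a) = Real.sin (2 * Real.pi * b) := by
    have := mul_left_cancel₀ hr.ne' h1
    linarith
  have c2 := mul_left_cancel₀ hr.ne' h2
  have : Real.cos (2 * Real.pi * a - 2 * Real.pi * b) = 1 := by
    rw [Real.cos_sub, c1, c2]; nlinarith
  obtain ⟨k, hk⟩ := (Real.cos_eq_one_iff _).mp this
  refine ⟨k, ?_⟩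
  have hp := Real.pi_pos
  have : 2 * Real.pi * (a - b - k) = 0 := by linarith
  have h3 : a - b - k = 0 := by
    rcases mul_eq_zero.mp this with h | h
    · linarith
    · exact h
  linarith

theorem exists_uu (w : Pl) (hw : w ≠ 0) : ∃ r : ℝ, 0 < r ∧ ∃ θ, w = r • uu θ := by
  have hz : (⟨w.2, -w.1⟩ : ℂ) ≠ 0 := by
    intro h
    apply hw
    have h1 := congrArg Complex.re h
    have h2 := congrArg Complex.im h
    simp at h1 h2
    exact Prod.ext h2 h1
  set z : ℂ := ⟨w.2, -w.1⟩ with hzdef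
  refine ⟨‖z‖, norm_pos_iff.mpr hz, Complex.arg z / (2 * Real.pi), ?_⟩
  have hp := Real.pi_pos
  have : 2 * Real.pi * (Complex.arg z / (2 * Real.pi)) = Complex.arg z := by field_simp
  unfold uu
  rw [this]
  have a1 := Complex.norm_mul_cos_arg z
  have a2 := Complex.norm_mul_sin_arg z
  ext
  · simp only [Prod.smul_fst, smul_eq_mul, mul_neg, a2]; simp [hzdef]
  · simp only [Prod.smul_snd, smul_eq_mul, a1]; simp [hzdef]

/-- A continuous integer-valued function on a preconnected set is constant. -/
theorem const_of_int {X : Type*} [TopologicalSpace X] {s : Set X} (hs : IsPreconnected s)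
    {g : X → ℝ} (hg : ContinuousOn g s) (hinteg : ∀ x ∈ s, ∃ k : ℤ, g x = k)
    {x y : X} (hx : x ∈ s) (hy : y ∈ s) : g x = g y := by
  have h1 := (hs.image g hg).ordConnected
  by_contra hne
  wlog hlt : g x < g y generalizing x y
  · exact this hy hx (Ne.symm hne) (lt_of_le_of_ne (not_lt.mp hlt) (Ne.symm hne))
  obtain ⟨k, hk⟩ := hinteg x hx
  obtain ⟨l, hl⟩ := hinteg y hy
  have hkl : k < l := by rw [hk, hl] at hlt; exact_mod_cast hlt
  have hkl' : (k : ℝ) + 1 ≤ l := by exact_mod_cast hkl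
  have : g x + 1 / 2 ∈ g '' s :=
    h1.out (mem_image_of_mem g hx) (mem_image_of_mem g hy) ⟨by linarith, by linarith⟩
  obtain ⟨z, hz, hz'⟩ := this
  obtain ⟨j, hj⟩ := hinteg z hz
  rw [hj, hk] at hz'
  have : (2 * j : ℝ) = 2 * k + 1 := by linarith
  have : 2 * j = 2 * k + 1 := by exact_mod_cast this
  omega

namespace IsotopySetup

variable (S : IsotopySetup)

theorem fderiv_Ft_ne {t : ℝ} (ht : t ∈ Icc (0:ℝ) 1) (p w : Pl) (hw : w ≠ 0) :
    fderiv ℝ (S.Ft t) p w ≠ 0 := by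
  obtain ⟨G, hG, hl, -⟩ := S.Ft_diffeo t ht
  intro h
  have h1 : HasFDerivAt (S.Ft t) (fderiv ℝ (S.Ft t) p) p :=
    ((S.Ft_smooth t ht).differentiable one_ne_zero p).hasFDerivAt
  have h2 : HasFDerivAt G (fderiv ℝ G (S.Ft t p)) (S.Ft t p) :=
    (hG.differentiable one_ne_zero _).hasFDerivAt
  have h3 := h2.comp p h1
  have h4 : G ∘ S.Ft t = id := funext hl
  rw [h4] at h3
  have h5 := h3.unique (hasFDerivAt_id p)
  have h6 := congrArg (fun T : Pl →L[ℝ] Pl => T w) h5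
  simp [h] at h6
  exact hw h6.symm

/-- clamp -/
def cl (t : ℝ) : ℝ := max 0 (min 1 t)

theorem cl_mem (t : ℝ) : cl t ∈ Icc (0:ℝ) 1 := by
  unfold cl; constructor <;> simp

theorem cl_of {t : ℝ} (ht : t ∈ Icc (0:ℝ) 1) : cl t = t := by
  unfold cl; rw [min_eq_right ht.2, max_eq_right ht.1]

theorem continuous_cl : Continuous cl := by unfold cl; fun_prop

/-- averaged difference quotient -/
def Hm (t : ℝ) (p : Pl) (θ m : ℝ) : Pl :=
  ∫ s in (0:ℝ)..1, fderiv ℝ (S.Ft (cl t)) (p + (s * m) • uu θ) (uu θ)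

theorem continuous_dcl : Continuous (fun q : ℝ × Pl => fderiv ℝ (S.Ft (cl q.1)) q.2) := by
  have := S.DFt_cont.comp_continuous (f := fun q : ℝ × Pl => (cl q.1, q.2))
    (by have := continuous_cl; fun_prop) (fun q => ⟨cl_mem _, mem_univ _⟩)
  exact this

theorem continuous_Hm : Continuous (fun q : ℝ × Pl × ℝ × ℝ => S.Hm q.1 q.2.1 q.2.2.1 q.2.2.2) := by
  unfold Hm
  apply intervalIntegral.continuous_parametric_intervalIntegral_of_continuous'
  have h := S.continuous_dcl
  have hu := continuous_uu
  have h1 : Continuous (fun a : (ℝ × Pl × ℝ × ℝ) × ℝ =>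
    fderiv ℝ (S.Ft (cl a.1.1)) (a.1.2.1 + (a.2 * a.1.2.2.2) • uu a.1.2.2.1)) :=
    h.comp (g := fun q : ℝ × Pl => fderiv ℝ (S.Ft (cl q.1)) q.2)
     (f := fun a : (ℝ × Pl × ℝ × ℝ) × ℝ =>
      (a.1.1, (a.1.2.1 + (a.2 * a.1.2.2.2) • uu a.1.2.2.1))) (by fun_prop)
  exact h1.clm_apply (by fun_prop)

theorem Hm_zero {t : ℝ} (ht : t ∈ Icc (0:ℝ) 1) (p : Pl) (θ : ℝ) :
    S.Hm t p θ 0 = fderiv ℝ (S.Ft t) p (uu θ) := by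
  simp [Hm, cl_of ht]

theorem smul_Hm {t : ℝ} (ht : t ∈ Icc (0:ℝ) 1) (p : Pl) (θ m : ℝ) :
    m • S.Hm t p θ m = S.Ft t (p + m • uu θ) - S.Ft t p := by
  unfold Hm
  rw [cl_of ht, ← intervalIntegral.integral_smul]
  have hd : ∀ s : ℝ, HasDerivAt (fun s : ℝ => S.Ft t (p + (s * m) • uu θ))
      (m • fderiv ℝ (S.Ft t) (p + (s * m) • uu θ) (uu θ)) s := by
    intro s
    have h1 : HasFDerivAt (S.Ft t) (fderiv ℝ (S.Ft t) (p + (s * m) • uu θ)) (p + (s * m) • uu θ) :=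
      ((S.Ft_smooth t ht).differentiable one_ne_zero _).hasFDerivAt
    have h2 : HasDerivAt (fun s : ℝ => p + (s * m) • uu θ) (m • uu θ) s := by
      have := (((hasDerivAt_id s).mul_const m).smul_const (uu θ)).const_add p
      simpa using this
    have := h1.comp_hasDerivAt s h2
    rw [map_smul] at this
    exact this
  have hc : Continuous (fun s : ℝ => m • fderiv ℝ (S.Ft t) (p + (s * m) • uu θ) (uu θ)) := by
    have h1 := (S.Ft_smooth t ht).continuous_fderiv one_ne_zero
    have h2 : Continuous (fun s : ℝ => fderiv ℝ (S.Ft t) (p + (s * m) • uu θ)) :=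
      h1.comp (by fun_prop)
    exact (h2.clm_apply continuous_const).const_smul m
  rw [intervalIntegral.integral_eq_sub_of_hasDerivAt (fun s _ => hd s) (hc.intervalIntegrable _ _)]
  simp

theorem Hm_ne {t : ℝ} (ht : t ∈ Icc (0:ℝ) 1) (p : Pl) (θ m : ℝ) : S.Hm t p θ m ≠ 0 := by
  by_cases hm : m = 0
  · subst hm
    rw [S.Hm_zero ht]
    exact S.fderiv_Ft_ne ht _ _ (uu_ne θ)
  · intro h
    have h1 := S.smul_Hm ht p θ m
    rw [h, smul_zero] at h1
    obtain ⟨G, -, hl, -⟩ := S.Ft_diffeo t ht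
    have h2 := hl.injective (sub_eq_zero.mp h1.symm)
    have h3 : m • uu θ = 0 := by simpa using h2
    rcases smul_eq_zero.mp h3 with h | h
    · exact hm h
    · exact uu_ne θ h

theorem Hm_time_zero (p : Pl) (θ m : ℝ) : S.Hm 0 p θ m = uu θ := by
  have : cl 0 = 0 := cl_of ⟨le_refl _, zero_le_one⟩
  simp [Hm, this, S.Ft_zero]

/-- The vector `(x,y)` as the complex number `y - i x`. -/
def toC (w : Pl) : ℂ := ⟨w.2, -w.1⟩

theorem continuous_toC : Continuous toC := by
  have : toC = fun w : Pl => ((w.2 : ℂ) + (-w.1 : ℝ) * Complex.I) := by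
    funext w; apply Complex.ext <;> simp [toC]
  rw [this]; fun_prop

theorem toC_ne {w : Pl} (hw : w ≠ 0) : toC w ≠ 0 := by
  intro h
  apply hw
  have h1 := congrArg Complex.re h
  have h2 := congrArg Complex.im h
  simp [toC] at h1 h2
  exact Prod.ext h2 h1

theorem exists_psi : ∃ ψ : ℝ → Pl → ℝ → ℝ → ℝ,
    Continuous (fun q : ℝ × Pl × ℝ × ℝ => ψ q.1 q.2.1 q.2.2.1 q.2.2.2) ∧
    (∀ p θ m, ψ 0 p θ m = θ) ∧
    ∀ t ∈ Icc (0:ℝ) 1, ∀ p θ m, ∃ r : ℝ, 0 < r ∧ S.Hm t p θ m = r • uu (ψ t p θ m) := by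
  have cov := Complex.isCoveringMap_exp
  let H : C(unitInterval × (Pl × ℝ × ℝ), {z : ℂ // z ≠ 0}) :=
    ⟨fun q => ⟨toC (S.Hm q.1 q.2.1 q.2.2.1 q.2.2.2), toC_ne (S.Hm_ne q.1.2 _ _ _)⟩, by
      apply Continuous.subtype_mk
      exact continuous_toC.comp (S.continuous_Hm.comp
        (f := fun q : unitInterval × (Pl × ℝ × ℝ) => ((q.1 : ℝ), q.2)) (by fun_prop))⟩
  let f0 : C(Pl × ℝ × ℝ, ℂ) := ⟨fun q => ((2 * Real.pi * q.2.1 : ℝ) : ℂ) * Complex.I, by fun_prop⟩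
  have hH0 : ∀ a, H (0, a) = ⟨Complex.exp (f0 a), Complex.exp_ne_zero _⟩ := by
    intro a
    apply Subtype.ext
    show toC (S.Hm _ _ _ _) = Complex.exp (((2 * Real.pi * a.2.1 : ℝ) : ℂ) * Complex.I)
    have : (((0 : unitInterval), a).1 : ℝ) = 0 := rfl
    rw [this, S.Hm_time_zero]
    apply Complex.ext
    · rw [Complex.exp_ofReal_mul_I_re]; simp [toC, uu]
    · rw [Complex.exp_ofReal_mul_I_im]; simp [toC, uu]
  let Lf := cov.liftHomotopy H f0 hH0
  have h1 := cov.liftHomotopy_lifts H f0 hH0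
  have h2 := cov.liftHomotopy_zero H f0 hH0
  have hp := Real.pi_pos
  refine ⟨fun t p θ m => (Lf (projIcc 0 1 zero_le_one t, (p, θ, m))).im / (2 * Real.pi), ?_, ?_, ?_⟩
  · have hc : Continuous (fun t : ℝ => projIcc (0:ℝ) 1 zero_le_one t) := continuous_projIcc
    have : Continuous (fun q : ℝ × Pl × ℝ × ℝ =>
      Lf (projIcc 0 1 zero_le_one q.1, (q.2.1, q.2.2.1, q.2.2.2))) := by
      apply Lf.continuous.comp
      exact (hc.comp continuous_fst).prodMk (by fun_prop)
    exact (Complex.continuous_im.comp this).div_const _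
  · intro p θ m
    have : projIcc (0:ℝ) 1 zero_le_one 0 = (0 : unitInterval) := projIcc_left zero_le_one
    simp only [this]
    have := h2 (p, θ, m)
    show (cov.liftHomotopy H f0 hH0 _).im / _ = _
    rw [this]
    simp [f0]
  · intro t ht p θ m
    set a : unitInterval × (Pl × ℝ × ℝ) := (projIcc 0 1 zero_le_one t, (p, θ, m)) with ha
    have h3 := congrArg Subtype.val (congrFun h1 a)
    have hpt : ((projIcc (0:ℝ) 1 zero_le_one t : unitInterval) : ℝ) = t := by
      rw [projIcc_of_mem zero_le_one ht]
    have h4 : Complex.exp (Lf a) = toC (S.Hm t p θ m) := by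
      have h5 : ((H a : {z : ℂ // z ≠ 0}) : ℂ) = toC (S.Hm t p θ m) := by
        show toC (S.Hm (a.1 : ℝ) _ _ _) = _
        rw [ha, hpt]
      rw [← h5]; exact h3
    refine ⟨Real.exp (Lf a).re, Real.exp_pos _, ?_⟩
    have e1 := congrArg Complex.re h4
    have e2 := congrArg Complex.im h4
    rw [Complex.exp_re] at e1
    rw [Complex.exp_im] at e2
    have hq : 2 * Real.pi * ((Lf a).im / (2 * Real.pi)) = (Lf a).im := by field_simp
    simp only [toC] at e1 e2
    show _ = Real.exp (Lf a).re • uu ((Lf a).im / (2 * Real.pi))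
    apply Prod.ext
    · simp only [uu, hq, Prod.smul_fst, smul_eq_mul]; linarith
    · simp only [uu, hq, Prod.smul_snd, smul_eq_mul]; linarith

end IsotopySetup

namespace IsotopySetup

variable (S : IsotopySetup)

def psi : ℝ → Pl → ℝ → ℝ → ℝ := S.exists_psi.choose

theorem continuous_psi :
    Continuous (fun q : ℝ × Pl × ℝ × ℝ => S.psi q.1 q.2.1 q.2.2.1 q.2.2.2) :=
  S.exists_psi.choose_spec.1

theorem psi_zero (p : Pl) (θ m : ℝ) : S.psi 0 p θ m = θ := S.exists_psi.choose_spec.2.1 p θ m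

theorem psi_spec {t : ℝ} (ht : t ∈ Icc (0:ℝ) 1) (p : Pl) (θ m : ℝ) :
    ∃ r : ℝ, 0 < r ∧ S.Hm t p θ m = r • uu (S.psi t p θ m) :=
  S.exists_psi.choose_spec.2.2 t ht p θ m

theorem psi_spec0 {t : ℝ} (ht : t ∈ Icc (0:ℝ) 1) (p : Pl) (θ : ℝ) :
    ∃ r : ℝ, 0 < r ∧ fderiv ℝ (S.Ft t) p (uu θ) = r • uu (S.psi t p θ 0) := by
  obtain ⟨r, hr, h⟩ := S.psi_spec ht p θ 0
  exact ⟨r, hr, by rw [← h, S.Hm_zero ht]⟩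

theorem continuous_psi_t (p : Pl) (θ m : ℝ) : Continuous (fun t => S.psi t p θ m) :=
  S.continuous_psi.comp (f := fun t : ℝ => (t, p, θ, m)) (by fun_prop)

theorem zero_mem : (0:ℝ) ∈ Icc (0:ℝ) 1 := ⟨le_refl _, zero_le_one⟩
theorem one_mem : (1:ℝ) ∈ Icc (0:ℝ) 1 := ⟨zero_le_one, le_refl _⟩

def phi (p : Pl) (θ : ℝ) : ℝ := S.psi 1 p θ 0

theorem continuous_phi : Continuous (fun q : Pl × ℝ => S.phi q.1 q.2) :=
  S.continuous_psi.comp (f := fun q : Pl × ℝ => ((1:ℝ), q.1, q.2, (0:ℝ))) (by fun_prop)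

theorem phi_spec (p : Pl) (θ : ℝ) :
    ∃ r : ℝ, 0 < r ∧ fderiv ℝ S.F p (uu θ) = r • uu (S.phi p θ) := S.psi_spec0 one_mem p θ

theorem phi_half (p : Pl) (θ : ℝ) : S.phi p (θ + 1 / 2) = S.phi p θ + 1 / 2 := by
  have key := const_of_int (s := Icc (0:ℝ) 1) isPreconnected_Icc
    (g := fun t => S.psi t p (θ + 1 / 2) 0 - (S.psi t p θ 0 + 1 / 2))
    (by
      have h1 := S.continuous_psi_t p (θ + 1 / 2) 0
      have h2 := S.continuous_psi_t p θ 0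
      exact (h1.sub (h2.add_const _)).continuousOn)
    (by
      intro t ht
      obtain ⟨r, hr, h1⟩ := S.psi_spec0 ht p (θ + 1 / 2)
      obtain ⟨s, hs, h2⟩ := S.psi_spec0 ht p θ
      apply uu_eq_imp hr hs
      rw [← h1, uu_add_half, uu_add_half, map_neg, h2, smul_neg])
    one_mem zero_mem
  simp only [psi_zero] at key
  unfold phi
  linarith

theorem phi_one (p : Pl) (θ : ℝ) : S.phi p (θ + 1) = S.phi p θ + 1 := by
  have : θ + 1 = θ + 1 / 2 + 1 / 2 := by ring
  rw [this, phi_half, phi_half]; ring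

theorem uu_int (θ : ℝ) (k : ℤ) : uu (θ + k) = uu θ := by
  have : 2 * Real.pi * (θ + k) = 2 * Real.pi * θ + k * (2 * Real.pi) := by ring
  unfold uu
  rw [this, Real.sin_add_int_mul_two_pi, Real.cos_add_int_mul_two_pi]

theorem phi_int (p : Pl) (θ : ℝ) (k : ℤ) : S.phi p (θ + k) = S.phi p θ + k := by
  induction k with
  | zero => simp
  | succ i ih =>
    have : θ + ((i + 1 : ℤ) : ℝ) = θ + i + 1 := by push_cast; ring
    rw [this, phi_one]; push_cast at ih ⊢; rw [ih]; ring
  | pred i ih =>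
    have h := S.phi_one p (θ + ((-i - 1 : ℤ) : ℝ))
    have : θ + ((-i - 1 : ℤ) : ℝ) + 1 = θ + ((-i : ℤ) : ℝ) := by push_cast; ring
    rw [this, ih] at h
    push_cast at h ⊢
    linarith

theorem phi_strictMono (p : Pl) : StrictMono (S.phi p) := by
  have hc : Continuous (S.phi p) :=
    S.continuous_phi.comp (f := fun θ : ℝ => (p, θ)) (by fun_prop)
  have hinj : Injective (S.phi p) := by
    intro a b hab
    obtain ⟨r, hr, h1⟩ := S.phi_spec p a
    obtain ⟨s, hs, h2⟩ := S.phi_spec p b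
    have h3 : fderiv ℝ S.F p (s • uu a - r • uu b) = 0 := by
      rw [map_sub, map_smul, map_smul, h1, h2, hab, smul_smul, smul_smul, mul_comm, sub_self]
    have h4 : s • uu a - r • uu b = 0 := by
      by_contra hne
      exact S.fderiv_Ft_ne one_mem p _ hne h3
    obtain ⟨k, hk⟩ := uu_eq_imp hs hr (sub_eq_zero.mp h4)
    have : a = b + k := by linarith
    rw [this, phi_int] at hab
    rw [this]
    linarith
  rcases hc.strictMono_of_inj hinj with h | h
  · exact h
  · exfalso
    have h1 := h (show (0:ℝ) < 0 + 1 by norm_num)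
    rw [phi_one] at h1
    linarith

theorem phi_zero_neg (htw : S.PosTwist) (p : Pl) : S.phi p 0 < 0 := by
  obtain ⟨hmono, hsurj, hder⟩ := htw p.1
  have hFs : ContDiff ℝ 1 S.F := S.Ft_smooth 1 one_mem
  have hFc : Continuous S.F := hFs.continuous
  obtain ⟨G, -, hG, -⟩ := S.Ft_diffeo 1 one_mem
  have hFinj : Injective S.F := hG.injective
  -- first coordinate of Hm at angle 0
  have hpos : ∀ m, 0 ≤ m → 0 < (S.Hm 1 p 0 m).1 := by
    intro m hm
    rcases hm.eq_or_lt with h | h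
    · subst h
      rw [S.Hm_zero one_mem, uu_zero]
      have h1 := hder p.2
      have h2 : HasFDerivAt S.F (fderiv ℝ S.F p) (p.1, p.2) :=
        (hFs.differentiable one_ne_zero p).hasFDerivAt
      have h3 : HasDerivAt (fun y : ℝ => ((p.1, y) : Pl)) ((0, 1) : Pl) p.2 :=
        (hasDerivAt_const p.2 p.1).prodMk (hasDerivAt_id p.2)
      have h4 := h2.comp_hasDerivAt p.2 h3
      have h5 : HasDerivAt (fun y : ℝ => (S.F (p.1, y)).1) (fderiv ℝ S.F p (0, 1)).1 p.2 :=
        (hasFDerivAt_fst (𝕜 := ℝ) (E := ℝ) (F := ℝ)).comp_hasDerivAt p.2 h4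
      rw [h5.deriv] at h1
      exact h1
    · have h1 := congrArg Prod.fst (S.smul_Hm one_mem p 0 m)
      simp only [Prod.smul_fst, smul_eq_mul, Prod.fst_sub, uu_zero] at h1
      have h2 : p + m • vv = (p.1, p.2 + m) := by
        apply Prod.ext <;> simp [vv]
      have h3 := hmono (show p.2 < p.2 + m by linarith)
      simp only at h3
      rw [h2] at h1
      change m * _ = (S.F (p.1, p.2 + m)).1 - (S.F (p.1, p.2)).1 at h1
      have h4 : 0 < m * (S.Hm 1 p 0 m).1 := by rw [h1]; linarith
      exact (pos_iff_pos_of_mul_pos h4).mp h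
  have hsin : ∀ m, 0 ≤ m → Real.sin (2 * Real.pi * S.psi 1 p 0 m) < 0 := by
    intro m hm
    obtain ⟨r, hr, h⟩ := S.psi_spec one_mem p 0 m
    have h1 := hpos m hm
    rw [h] at h1
    simp only [uu, Prod.smul_fst, smul_eq_mul] at h1
    have := (pos_iff_pos_of_mul_pos h1).mp hr
    linarith
  have hpi := Real.pi_pos
  by_contra hcon
  push Not at hcon
  have hcm : Continuous (fun m => S.psi 1 p 0 m) :=
    S.continuous_psi.comp (f := fun m : ℝ => ((1:ℝ), p, (0:ℝ), m)) (by fun_prop)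
  have h1pos : 0 < S.psi 1 p 0 1 := by
    by_contra hle
    push Not at hle
    have h0 : (0:ℝ) ∈ (fun m => S.psi 1 p 0 m) '' Icc 0 1 :=
      intermediate_value_Icc' zero_le_one hcm.continuousOn ⟨hle, hcon⟩
    obtain ⟨m, hm, hm0⟩ := h0
    have := hsin m hm.1
    simp only at hm0
    rw [hm0] at this
    simp at this
  have h1half : 1 / 2 < S.psi 1 p 0 1 := by
    by_contra hle
    push Not at hle
    have := hsin 1 zero_le_one
    have h2 : 0 ≤ Real.sin (2 * Real.pi * S.psi 1 p 0 1) :=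
      Real.sin_nonneg_of_nonneg_of_le_pi (by positivity) (by nlinarith)
    linarith
  -- the horizontal unit vector
  have hquart : S.psi 1 p (-1 / 4) 1 = -1 / 4 := by
    have key := const_of_int (s := Icc (0:ℝ) 1) isPreconnected_Icc
      (g := fun t => S.psi t p (-1 / 4) 1 - (-1 / 4))
      ((S.continuous_psi_t p (-1 / 4) 1).sub continuous_const).continuousOn
      (by
        intro t ht
        obtain ⟨r, hr, h1⟩ := S.psi_spec ht p (-1 / 4) 1
        apply uu_eq_imp hr one_pos
        rw [← h1]
        have h2 := S.smul_Hm ht p (-1 / 4) 1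
        rw [one_smul, one_smul, uu_quarter, S.Ft_periodic, add_sub_cancel_left] at h2
        rw [h2, one_smul, uu_quarter])
      one_mem zero_mem
    simp only [psi_zero] at key
    linarith
  have hcθ : Continuous (fun θ => S.psi 1 p θ 1) :=
    S.continuous_psi.comp (f := fun θ : ℝ => ((1:ℝ), p, θ, (1:ℝ))) (by fun_prop)
  -- images of points in the right half plane
  have hright : ∀ c : ℝ, 0 ≤ c → c ≤ 1 / 2 → ∃ q : Pl, p.1 < q.1 ∧ ∃ r : ℝ, 0 < r ∧
      S.F q = S.F p + r • uu c := by
    intro c hc hc'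
    have h0 : c ∈ (fun θ => S.psi 1 p θ 1) '' Icc (-1 / 4) 0 :=
      intermediate_value_Icc (by norm_num) hcθ.continuousOn
        ⟨by simp only [hquart]; linarith, by linarith⟩
    obtain ⟨θ, hθ, hθc⟩ := h0
    simp only at hθc
    have hθ0 : θ ≠ 0 := by
      rintro rfl
      linarith
    have hθneg : θ < 0 := lt_of_le_of_ne hθ.2 hθ0
    obtain ⟨r, hr, h⟩ := S.psi_spec one_mem p θ 1
    have h2 := S.smul_Hm one_mem p θ 1
    rw [one_smul, one_smul, h, hθc] at h2
    refine ⟨p + uu θ, ?_, r, hr, ?_⟩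
    · have : Real.sin (2 * Real.pi * θ) < 0 := by
        apply Real.sin_neg_of_neg_of_neg_pi_lt
        · nlinarith
        · have := hθ.1; nlinarith
      simp only [uu, Prod.fst_add]
      linarith
    · rw [h2]; simp [F]
  obtain ⟨q1, hq1, r1, hr1, e1⟩ := hright 0 (le_refl _) (by norm_num)
  obtain ⟨q2, hq2, r2, hr2, e2⟩ := hright (1 / 2) (by norm_num) (le_refl _)
  have hu2 : uu (1 / 2) = (0, -1) := by
    have := uu_add_half 0
    rw [zero_add, uu_zero] at this
    rw [this]; simp [vv]
  rw [uu_zero] at e1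
  rw [hu2] at e2
  -- the graph
  let e : ℝ ≃o ℝ := StrictMono.orderIsoOfSurjective _ hmono hsurj
  have he : ∀ y, e y = (S.F (p.1, y)).1 := fun y => rfl
  let g : Pl → ℝ := fun q => (S.F q).2 - (S.F (p.1, e.symm (S.F q).1)).2
  have hgc : Continuous g := by
    have h1 : Continuous e.symm := e.symm.continuous
    have h2 : Continuous (fun q : Pl => (S.F q).1) := continuous_fst.comp hFc
    exact (continuous_snd.comp hFc).sub (continuous_snd.comp (hFc.comp
      (continuous_const.prodMk (h1.comp h2))))
  have hgp : ∀ q : Pl, (S.F q).1 = (S.F p).1 → g q = (S.F q).2 - (S.F p).2 := by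
    intro q hq
    have : e.symm (S.F q).1 = p.2 := by
      rw [OrderIso.symm_apply_eq, he, hq]
    simp only [g, this]
  have hg1 : 0 < g q1 := by
    rw [hgp q1 (by rw [e1]; simp [vv]), e1]; simp [vv, hr1]
  have hg2 : g q2 < 0 := by
    rw [hgp q2 (by rw [e2]; simp), e2]; simp [hr2]
  have hconv : IsPreconnected {q : Pl | p.1 < q.1} := by
    apply Convex.isPreconnected
    exact convex_halfSpace_gt (IsLinearMap.mk (fun _ _ => rfl) (fun _ _ => rfl)) _
  have := (hconv.image g hgc.continuousOn).ordConnected.out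
    (mem_image_of_mem g hq2) (mem_image_of_mem g hq1) (show (0:ℝ) ∈ Icc _ _ from ⟨hg2.le, hg1.le⟩)
  obtain ⟨q, hq, hq0⟩ := this
  have hqe : S.F q = S.F (p.1, e.symm (S.F q).1) := by
    apply Prod.ext
    · rw [← he, OrderIso.apply_symm_apply]
    · simp only [g] at hq0; linarith
  have := congrArg Prod.fst (hFinj hqe)
  change p.1 < q.1 at hq
  simp only at this
  linarith

end IsotopySetup

namespace IsotopySetup

variable (S : IsotopySetup)

/-- lifted angle after `n` iterates -/
def bb : ℕ → Pl → ℝ → ℝ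
  | 0, _, θ => θ
  | (n + 1), p, θ => S.phi (S.F^[n] p) (bb n p θ)

theorem contDiff_F : ContDiff ℝ 1 S.F := S.Ft_smooth 1 one_mem

theorem continuous_bb (n : ℕ) : Continuous (fun q : Pl × ℝ => S.bb n q.1 q.2) := by
  induction n with
  | zero => exact continuous_snd
  | succ n ih =>
    exact S.continuous_phi.comp (f := fun q : Pl × ℝ => (S.F^[n] q.1, S.bb n q.1 q.2))
      (((S.contDiff_F.continuous.iterate n).comp continuous_fst).prodMk ih)

theorem bb_strictMono (n : ℕ) (p : Pl) : StrictMono (S.bb n p) := by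
  induction n with
  | zero => exact strictMono_id
  | succ n ih => exact (S.phi_strictMono _).comp ih

theorem bb_half (n : ℕ) (p : Pl) (θ : ℝ) : S.bb n p (θ + 1 / 2) = S.bb n p θ + 1 / 2 := by
  induction n with
  | zero => rfl
  | succ n ih => simp only [bb]; rw [ih, phi_half]

theorem bb_sub_half (n : ℕ) (p : Pl) (θ : ℝ) (k : ℕ) :
    S.bb n p (θ - k / 2) = S.bb n p θ - k / 2 := by
  induction k with
  | zero => simp
  | succ k ih =>
    have h := S.bb_half n p (θ - (k + 1 : ℕ) / 2)
    have : θ - ((k + 1 : ℕ) : ℝ) / 2 + 1 / 2 = θ - k / 2 := by push_cast; ring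
    rw [this, ih] at h
    rw [eq_sub_of_add_eq h.symm]
    push_cast; ring

theorem bb_add (m n : ℕ) (p : Pl) (θ : ℝ) :
    S.bb (m + n) p θ = S.bb n (S.F^[m] p) (S.bb m p θ) := by
  induction n with
  | zero => rfl
  | succ n ih =>
    rw [← add_assoc]
    simp only [bb]
    rw [ih, ← Function.iterate_add_apply, add_comm n m]

theorem fderiv_iter_succ (n : ℕ) (p : Pl) :
    fderiv ℝ (S.F^[n + 1]) p = (fderiv ℝ S.F (S.F^[n] p)).comp (fderiv ℝ (S.F^[n]) p) := by
  rw [Function.iterate_succ']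
  exact fderiv_comp p (S.contDiff_F.differentiable one_ne_zero _)
    ((S.contDiff_F.differentiable one_ne_zero).iterate n _)

theorem bb_spec (n : ℕ) (p : Pl) (θ : ℝ) :
    ∃ r : ℝ, 0 < r ∧ fderiv ℝ (S.F^[n]) p (uu θ) = r • uu (S.bb n p θ) := by
  induction n with
  | zero => exact ⟨1, one_pos, by simp [bb]⟩
  | succ n ih =>
    obtain ⟨r, hr, h⟩ := ih
    obtain ⟨s, hs, h'⟩ := S.phi_spec (S.F^[n] p) (S.bb n p θ)
    refine ⟨r * s, mul_pos hr hs, ?_⟩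
    rw [fderiv_iter_succ, ContinuousLinearMap.comp_apply, h, map_smul, h', smul_smul]
    rfl

/-- The lifted angle in continuous time. -/
def Th (p : Pl) (θ t : ℝ) : ℝ := S.psi (Int.fract t) (S.F^[⌊t⌋₊] p) (S.bb ⌊t⌋₊ p θ) 0

theorem Th_nat (p : Pl) (θ : ℝ) (n : ℕ) : S.Th p θ n = S.bb n p θ := by
  simp [Th, psi_zero]

theorem Th_eq (p : Pl) (θ : ℝ) (n : ℕ) {t : ℝ} (ht : t ∈ Icc (n:ℝ) (n + 1)) :
    S.Th p θ t = S.psi (t - n) (S.F^[n] p) (S.bb n p θ) 0 := by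
  rcases ht.2.eq_or_lt with h | h
  · have : t = ((n + 1 : ℕ) : ℝ) := by rw [h]; push_cast; ring
    rw [this, Th_nat]
    push_cast
    rw [add_sub_cancel_left]
    rfl
  · have h1 : ⌊t⌋₊ = n := by
      rw [Nat.floor_eq_iff ((Nat.cast_nonneg n).trans ht.1)]
      exact ⟨ht.1, h⟩
    have h2 : Int.fract t = t - n := by
      rw [Int.fract_eq_iff]
      refine ⟨by linarith [ht.1], by linarith, n, by push_cast; ring⟩
    unfold Th
    rw [h1, h2]

theorem Th_continuousOn (p : Pl) (θ : ℝ) (n : ℕ) : ContinuousOn (S.Th p θ) (Icc 0 (n:ℝ)) := by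
  induction n with
  | zero => simp
  | succ n ih =>
    have h1 : Icc (0:ℝ) ((n + 1 : ℕ) : ℝ) = Icc 0 (n:ℝ) ∪ Icc (n:ℝ) (n + 1) := by
      rw [Icc_union_Icc_eq_Icc (Nat.cast_nonneg n) (by linarith)]; push_cast; rfl
    rw [h1]
    refine ih.union_of_isClosed ?_ isClosed_Icc isClosed_Icc
    have h2 : Continuous (fun t : ℝ => S.psi (t - n) (S.F^[n] p) (S.bb n p θ) 0) :=
      (S.continuous_psi_t (S.F^[n] p) (S.bb n p θ) 0).comp (f := fun t : ℝ => t - n) (by fun_prop)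
    exact h2.continuousOn.congr (fun t ht => S.Th_eq p θ n ht)

theorem Th_spec (p : Pl) (θ t : ℝ) :
    ∃ r : ℝ, 0 < r ∧ S.D t p (uu θ) = r • uu (S.Th p θ t) := by
  obtain ⟨r, hr, h⟩ := S.bb_spec ⌊t⌋₊ p θ
  obtain ⟨s, hs, h'⟩ := S.psi_spec0 (t := Int.fract t) ⟨Int.fract_nonneg t, (Int.fract_lt_one t).le⟩
    (S.F^[⌊t⌋₊] p) (S.bb ⌊t⌋₊ p θ)
  refine ⟨r * s, mul_pos hr hs, ?_⟩
  unfold D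
  rw [ContinuousLinearMap.comp_apply, h, map_smul, h', smul_smul]
  rfl

theorem angleVar_bb (p : Pl) {r : ℝ} (hr : 0 < r) (θ : ℝ) (n : ℕ) :
    S.AngleVar p (r • uu θ) n (S.bb n p θ - θ) := by
  refine ⟨S.Th p θ, S.Th_continuousOn p θ n, ?_, ?_⟩
  · intro t _
    obtain ⟨s, hs, h⟩ := S.Th_spec p θ t
    exact ⟨r * s, mul_pos hr hs, by rw [map_smul, h, smul_smul]; rfl⟩
  · have h0 := S.Th_nat p θ 0
    rw [Nat.cast_zero] at h0
    rw [Th_nat, h0]; rfl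

theorem angleVar_vv (p : Pl) (n : ℕ) : S.AngleVar p vv n (S.bb n p 0) := by
  have := S.angleVar_bb p one_pos 0 n
  rwa [one_smul, uu_zero, sub_zero] at this

theorem angleVar_unique {p w : Pl} {n : ℕ} {a a' : ℝ} (h : S.AngleVar p w n a)
    (h' : S.AngleVar p w n a') : a = a' := by
  obtain ⟨Θ, hc, hs, rfl⟩ := h
  obtain ⟨Θ', hc', hs', rfl⟩ := h'
  have key := const_of_int (s := Icc (0:ℝ) n) isPreconnected_Icc
    (g := fun t => Θ t - Θ' t) (hc.sub hc')
    (by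
      intro t ht
      obtain ⟨r, hr, h1⟩ := hs t ht
      obtain ⟨s, hs, h2⟩ := hs' t ht
      exact uu_eq_imp hr hs (h1.symm.trans h2))
    (x := n) (y := 0) ⟨Nat.cast_nonneg n, le_refl _⟩ ⟨le_refl _, Nat.cast_nonneg n⟩
  linarith

/-! deck transformations -/

theorem Ft_int (t : ℝ) (p : Pl) (k : ℤ) : S.Ft t (p + ((k : ℝ), 0)) = S.Ft t p + ((k : ℝ), 0) := by
  induction k with
  | zero => have : (((0 : ℤ) : ℝ), (0 : ℝ)) = (0 : Pl) := by simp
            rw [this]; simp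
  | succ i ih =>
    have : (((i + 1 : ℤ) : ℝ), (0 : ℝ)) = (((i : ℤ) : ℝ), (0 : ℝ)) + ((1, 0) : Pl) := by simp
    rw [this, ← add_assoc, S.Ft_periodic, ih, add_assoc]
  | pred i ih =>
    have h := S.Ft_periodic t (p + (((-i - 1 : ℤ) : ℝ), 0))
    have e : (((-i - 1 : ℤ) : ℝ), (0 : ℝ)) + ((1, 0) : Pl) = (((-i : ℤ) : ℝ), (0 : ℝ)) := by simp
    rw [add_assoc, e, ih, ← e, ← add_assoc] at h
    exact (add_right_cancel h).symm

theorem F_iter_int (n : ℕ) (p : Pl) (k : ℤ) :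
    S.F^[n] (p + ((k : ℝ), 0)) = S.F^[n] p + ((k : ℝ), 0) := by
  induction n generalizing p with
  | zero => rfl
  | succ n ih =>
    rw [Function.iterate_succ_apply, Function.iterate_succ_apply]
    have : S.F (p + ((k : ℝ), 0)) = S.F p + ((k : ℝ), 0) := S.Ft_int 1 p k
    rw [this, ih]

theorem fderiv_transl {g : Pl → Pl} {c : Pl} (h : ∀ p, g (p + c) = g p + c) (p : Pl) :
    fderiv ℝ g (p + c) = fderiv ℝ g p := by
  rw [← fderiv_comp_add_right c]
  have : (fun x => g (x + c)) = fun x => g x + c := funext h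
  rw [this, fderiv_add_const]

theorem D_int (t : ℝ) (p : Pl) (k : ℤ) : S.D t (p + ((k : ℝ), 0)) = S.D t p := by
  unfold D
  rw [fderiv_transl (fun q => S.F_iter_int _ q k), S.F_iter_int,
    fderiv_transl (fun q => S.Ft_int _ q k)]

theorem pr_eq {p q : Pl} (h : pr p = pr q) : ∃ k : ℤ, q = p + ((k : ℝ), 0) := by
  have h1 : (p.1 : AddCircle (1:ℝ)) = q.1 := congrArg (Prod.fst : Ann → AddCircle (1:ℝ)) h
  have h2 : p.2 = q.2 := congrArg (Prod.snd : Ann → ℝ) h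
  have h3 : ((q.1 - p.1 : ℝ) : AddCircle (1:ℝ)) = 0 := by
    rw [AddCircle.coe_sub, h1, sub_self]
  obtain ⟨k, hk⟩ := AddCircle.coe_eq_zero_iff (1:ℝ) |>.mp h3
  refine ⟨k, Prod.ext ?_ ?_⟩
  · simp at hk ⊢; linarith
  · simp [h2]

theorem bb_deck {p q : Pl} (h : pr p = pr q) (n : ℕ) : S.bb n p 0 = S.bb n q 0 := by
  obtain ⟨k, rfl⟩ := pr_eq h
  apply S.angleVar_unique (S.angleVar_vv p n)
  have := S.angleVar_vv (p + ((k : ℝ), 0)) n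
  unfold AngleVar at this ⊢
  simpa only [D_int] using this

end IsotopySetup

namespace IsotopySetup

variable (S : IsotopySetup)

theorem pr_iter (n : ℕ) (p : Pl) : pr (S.F^[n] p) = S.f^[n] (pr p) := by
  have h : Function.Semiconj pr S.F S.f := S.lift_f
  exact (h.iterate_right n) p

theorem pr_surj (z : Ann) : ∃ p : Pl, pr p = z := by
  obtain ⟨x, y⟩ := z
  obtain ⟨x', rfl⟩ := QuotientAddGroup.mk_surjective x
  exact ⟨(x', y), rfl⟩

theorem pr_open : IsOpenMap pr := by
  have h1 : IsOpenMap (fun x : ℝ => (x : AddCircle (1:ℝ))) := QuotientAddGroup.isOpenMap_coe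
  exact h1.prodMap IsOpenMap.id

theorem bb_nonpos (htw : S.PosTwist) (n : ℕ) (p : Pl) : S.bb n p 0 ≤ 0 := by
  induction n with
  | zero => exact le_refl _
  | succ n ih =>
    exact ((S.phi_strictMono _).monotone ih).trans (S.phi_zero_neg htw _).le

theorem torsion_of_bdd (p : Pl) (h0 : ∀ n, S.bb n p 0 ≤ 0) (h1 : ∀ n, -1 / 2 ≤ S.bb n p 0) :
    S.TorsionLift p 0 := by
  intro w hw
  obtain ⟨r, hr, θ, rfl⟩ := exists_uu w hw
  refine ⟨fun n => S.bb n p θ - θ, fun n _ => S.angleVar_bb p hr θ n, ?_⟩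
  obtain ⟨k, hk⟩ := exists_nat_ge (2 * |θ|)
  have hθ := abs_le.mp (show |θ| ≤ k / 2 by linarith)
  have hb : ∀ n, |S.bb n p θ - θ| ≤ k + 1 := by
    intro n
    have a1 := (S.bb_strictMono n p).monotone (show 0 - (k:ℝ) / 2 ≤ θ by linarith)
    have a2 := (S.bb_strictMono n p).monotone (show θ - (k:ℝ) / 2 ≤ 0 by linarith)
    rw [bb_sub_half] at a1 a2
    rw [abs_le]
    constructor <;> linarith [h0 n, h1 n]
  refine squeeze_zero_norm (a := fun n : ℕ => ((k : ℝ) + 1) / n) ?_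
    (tendsto_const_div_atTop_nhds_zero_nat _)
  intro n
  rw [norm_div, Real.norm_eq_abs, Real.norm_natCast]
  gcongr
  exact hb n

theorem over_persist (htw : S.PosTwist) (p : Pl) (n j : ℕ) (h : S.bb n p 0 < -1 / 2) :
    S.bb (n + j) p 0 < -1 / 2 := by
  rw [bb_add]
  have a1 := S.bb_strictMono j (S.F^[n] p) (show S.bb n p 0 < 0 - ((1 : ℕ) : ℝ) / 2 by
    push_cast; linarith)
  rw [bb_sub_half] at a1
  have := S.bb_nonpos htw j (S.F^[n] p)
  push_cast at a1
  linarith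

open Classical in
theorem visits (htw : S.PosTwist) (m : ℕ) (W : Set Ann)
    (hW : ∀ q : Pl, pr q ∈ W → S.bb m q 0 < -1 / 2) (p : Pl) (N : ℕ) :
    S.bb (m * N) p 0 ≤
      -(((Finset.range N).filter (fun i => (S.f^[m])^[i] (pr p) ∈ W)).card : ℝ) / 2 := by
  induction N with
  | zero => simp [bb]
  | succ N ih =>
    set c := ((Finset.range N).filter (fun i => (S.f^[m])^[i] (pr p) ∈ W)).card with hc
    rw [mul_add, mul_one, bb_add]
    have a1 := (S.bb_strictMono m (S.F^[m * N] p)).monotone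
      (show S.bb (m * N) p 0 ≤ 0 - (c : ℝ) / 2 by linarith)
    rw [bb_sub_half] at a1
    have hpr : pr (S.F^[m * N] p) = (S.f^[m])^[N] (pr p) := by
      rw [pr_iter, Function.iterate_mul]
    rw [Finset.range_add_one, Finset.filter_insert]
    split_ifs with hv
    · rw [Finset.card_insert_of_notMem (by simp), ← hc]
      have := hW _ (hpr ▸ hv)
      push_cast
      linarith
    · have := S.bb_nonpos htw m (S.F^[m * N] p)
      rw [← hc]
      linarith

end IsotopySetup

theorem no_over_aux (S : IsotopySetup) (htwist : S.PosTwist)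
    (hpres : MeasurePreserving S.f volume volume)
    (U : Set Ann) (hUopen : IsOpen U) (hUfin : volume U < ⊤)
    (hUper : ∃ M : ℕ, 1 ≤ M ∧ S.f^[M] '' U = U)
    (hae : ∀ᵐ z ∂volume, z ∈ U → S.Torsion z 0) : ∀ z ∈ U, ¬ S.OverConj z := by
  classical
  rintro z hz ⟨p, rfl, n, hn, a, ha, ha'⟩
  obtain ⟨M, hM, hMU⟩ := hUper
  rw [S.angleVar_unique ha (S.angleVar_vv p n)] at ha'
  obtain ⟨j, hj⟩ : ∃ j, M * n = n + j := Nat.exists_eq_add_of_le (Nat.le_mul_of_pos_left n hM)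
  obtain ⟨m, hm⟩ : ∃ m, m = M * n := ⟨_, rfl⟩
  have hm1 : 1 ≤ m := by rw [hm]; exact Nat.mul_pos hM hn
  have hpm : S.bb m p 0 < -1 / 2 := by rw [hm, hj]; exact S.over_persist htwist p n j ha'
  let W : Set Ann := U ∩ pr '' {q | S.bb m q 0 < -1 / 2}
  have hWo : IsOpen W := by
    apply hUopen.inter
    apply IsotopySetup.pr_open
    apply isOpen_lt _ continuous_const
    exact (S.continuous_bb m).comp (f := fun q : Pl => (q, (0:ℝ))) (by fun_prop)
  have hWne : W.Nonempty := ⟨pr p, hz, p, hpm, rfl⟩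
  have hW : ∀ q : Pl, pr q ∈ W → S.bb m q 0 < -1 / 2 := by
    rintro q ⟨-, q', hq', hqq⟩
    rw [← S.bb_deck hqq]; exact hq'
  have hWpos : 0 < volume W := hWo.measure_pos volume hWne
  let g : Ann → Ann := S.f^[m]
  have hg : MeasurePreserving g volume volume := hpres.iterate m
  have hgU : U ⊆ g ⁻¹' U := by
    have h1 : MapsTo (S.f^[M]) U U := fun x hx => by
      rw [← hMU]; exact mem_image_of_mem _ hx
    have h2 := h1.iterate n
    rw [← Function.iterate_mul, ← hm] at h2
    exact h2
  let ν : Measure Ann := volume.restrict U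
  have hUm := hUopen.measurableSet
  have : IsFiniteMeasure ν := ⟨by simpa [ν] using hUfin⟩
  have hgν : MeasurePreserving g ν ν := by
    have h1 := hg.restrict_preimage hUm
    have h2 : U =ᵐ[volume] g ⁻¹' U := by
      apply ae_eq_of_subset_of_measure_ge hgU
      · rw [hg.measure_preimage hUm.nullMeasurableSet]
      · exact hUm.nullMeasurableSet
      · rw [hg.measure_preimage hUm.nullMeasurableSet]; exact hUfin.ne
    rw [← Measure.restrict_congr_set h2] at h1
    exact h1
  have hWm := hWo.measurableSet
  let V : ℕ → Ann → ℝ := fun N z =>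
    (∑ i ∈ Finset.range N, (g^[i] ⁻¹' W).indicator (fun _ => (1:ℝ)) z) / N
  have hmi : ∀ i, MeasurableSet (g^[i] ⁻¹' W) := fun i => (hgν.iterate i).measurable hWm
  have hVcard : ∀ N z, V N z =
      (((Finset.range N).filter (fun i => g^[i] z ∈ W)).card : ℝ) / N := by
    intro N z
    simp only [V, Set.indicator_apply, mem_preimage]
    rw [Finset.sum_boole]
  have hVle : ∀ N z, V N z ≤ 1 := by
    intro N z
    rw [hVcard]
    apply div_le_one_of_le₀ _ (Nat.cast_nonneg N)
    exact_mod_cast (Finset.card_filter_le _ _).trans (Finset.card_range N).le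
  have hV0 : ∀ N z, 0 ≤ V N z := by
    intro N z
    rw [hVcard]; positivity
  have hlim : ∀ᵐ z ∂ν, Tendsto (fun N => V N z) atTop (𝓝 0) := by
    rw [ae_restrict_iff' hUm]
    filter_upwards [hae] with z hz hzU
    obtain ⟨q, rfl, hq⟩ := hz hzU
    obtain ⟨b, hb, hb'⟩ := hq vv (by rw [← uu_zero]; exact uu_ne 0)
    have hsub : Tendsto (fun N : ℕ => m * N) atTop atTop :=
      tendsto_id.const_mul_atTop' hm1
    have hb2 := (hb'.comp hsub).const_mul (-2 * (m:ℝ))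
    rw [mul_zero] at hb2
    refine tendsto_of_tendsto_of_tendsto_of_le_of_le' tendsto_const_nhds hb2
      (Eventually.of_forall fun N => hV0 N _) ?_
    filter_upwards [eventually_ge_atTop 1] with N hN
    have hmN : 1 ≤ m * N := Nat.mul_pos hm1 hN
    have e1 := S.angleVar_unique (hb (m * N) hmN) (S.angleVar_vv q (m * N))
    have e2 := S.visits htwist m W hW q N
    simp only [Function.comp_apply]
    rw [hVcard, e1]
    have hNp : (0:ℝ) < N := by exact_mod_cast hN
    have hmp : (0:ℝ) < m := by exact_mod_cast hm1
    have : -2 * (m:ℝ) * (S.bb (m * N) q 0 / ((m * N : ℕ) : ℝ)) = (-2 * S.bb (m * N) q 0) / N := by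
      push_cast; field_simp
    rw [this]
    gcongr
    have e3 : ∀ c : ℝ, S.bb (m * N) q 0 ≤ -c / 2 → c ≤ -2 * S.bb (m * N) q 0 := by
      intro c hc; linarith
    refine le_of_eq_of_le ?_ (e3 _ e2)
    congr!
  have hVmeas : ∀ N, Measurable (V N) := fun N =>
    (Finset.measurable_sum _ fun i _ => measurable_const.indicator (hmi i)).div_const _
  have hinteg := tendsto_integral_of_dominated_convergence (μ := ν) (F := V) (f := fun _ => (0:ℝ))
    (fun _ => (1:ℝ)) (fun N => (hVmeas N).aestronglyMeasurable) (integrable_const _)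
    (fun N => Eventually.of_forall fun z => by
      rw [Real.norm_eq_abs, abs_of_nonneg (hV0 N z)]; exact hVle N z) hlim
  have hval : ∀ N : ℕ, 1 ≤ N → ∫ z, V N z ∂ν = ν.real W := by
    intro N hN
    simp only [V]
    rw [integral_div, integral_finsetSum _
      (fun i _ => (integrable_const _).indicator (hmi i))]
    have : ∀ i ∈ Finset.range N, ∫ z, (g^[i] ⁻¹' W).indicator (fun _ => (1:ℝ)) z ∂ν = ν.real W := by
      intro i _
      rw [integral_indicator_const _ (hmi i), smul_eq_mul, mul_one]
      simp only [Measure.real]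
      rw [(hgν.iterate i).measure_preimage hWm.nullMeasurableSet]
    rw [Finset.sum_congr rfl this]
    have hNp : (0:ℝ) < N := by exact_mod_cast hN
    simp
    field_simp
  rw [integral_zero] at hinteg
  have hc : Tendsto (fun N => ∫ z, V N z ∂ν) atTop (𝓝 (ν.real W)) := by
    apply tendsto_const_nhds.congr'
    filter_upwards [eventually_ge_atTop 1] with N hN
    exact (hval N hN).symm
  have h0 := tendsto_nhds_unique hc hinteg
  have hνW : ν W = volume W := by
    simp only [ν]
    rw [Measure.restrict_apply hWm, inter_eq_left.mpr (inter_subset_left)]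
  have : ν W = 0 := (measureReal_eq_zero_iff (measure_ne_top ν W)).mp h0
  rw [hνW] at this
  exact hWpos.ne' this

/-- For a positive twist map preserving Lebesgue measure and an `f`-periodic
open set `U` of finite measure: (zero torsion everywhere on `U`) ↔ (zero torsion a.e. on `U`)
↔ (no point of `U` has over-conjugate points). -/
theorem statement0 (S : IsotopySetup) (htwist : S.PosTwist)
    (hpres : MeasurePreserving S.f volume volume)
    (U : Set Ann) (hUopen : IsOpen U) (hUfin : volume U < ⊤)
    (hUper : ∃ M : ℕ, 1 ≤ M ∧ S.f^[M] '' U = U) :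
    ((∀ z ∈ U, S.Torsion z 0) ↔ (∀ᵐ z ∂volume, z ∈ U → S.Torsion z 0)) ∧
    ((∀ᵐ z ∂volume, z ∈ U → S.Torsion z 0) ↔ (∀ z ∈ U, ¬ S.OverConj z)) := by
  have h31 : (∀ z ∈ U, ¬ S.OverConj z) → ∀ z ∈ U, S.Torsion z 0 := by
    intro h z hz
    obtain ⟨p, rfl⟩ := IsotopySetup.pr_surj z
    refine ⟨p, rfl, S.torsion_of_bdd p (fun n => S.bb_nonpos htwist n p) fun n => ?_⟩
    rcases Nat.eq_zero_or_pos n with rfl | hn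
    · simp only [IsotopySetup.bb]; norm_num
    · by_contra hlt
      push Not at hlt
      exact h _ hz ⟨p, rfl, n, hn, _, S.angleVar_vv p n, hlt⟩
  have h12 : (∀ z ∈ U, S.Torsion z 0) → ∀ᵐ z ∂volume, z ∈ U → S.Torsion z 0 :=
    fun h => Eventually.of_forall h
  have h23 := no_over_aux S htwist hpres U hUopen hUfin hUper
  exact ⟨⟨h12, fun h => h31 (h23 h)⟩, ⟨h23, fun h => h12 (h31 h)⟩⟩

end
end

section
/- Let f : 𝔸 → 𝔸 be an exact symplectic positive twist map with lift F : ℝ² → ℝ². Then f is C⁰-integrable (i.e. 𝔸 is the disjoint union of a family of f-invariant images of essential curves) if and only if f has no conjugate points, i.e. for every z ∈ ℝ² and every n ≥ 1 the first component of DFⁿ(z)(0,1) is nonzero. -/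
noncomputable section

open MeasureTheory Set Filter Topology Function

namespace CS

/-- decomposition of a linear map on the plane -/
lemma lin_apply {E : Type*} [NormedAddCommGroup E] [NormedSpace ℝ E] (L : Pl →L[ℝ] E) (u v : ℝ) :
    L (u, v) = u • L (1, 0) + v • L (0, 1) := by
  have : ((u, v) : Pl) = u • ((1, 0) : Pl) + v • ((0, 1) : Pl) := by
    ext <;> simp
  rw [this, map_add, map_smul, map_smul]

/-- the linear equivalence `(u,v) ↦ (u, a u + b v)` -/
def shear (a b : ℝ) (hb : b ≠ 0) : Pl ≃L[ℝ] Pl :=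
  ContinuousLinearEquiv.equivOfInverse
    ((ContinuousLinearMap.fst ℝ ℝ ℝ).prod
      (a • ContinuousLinearMap.fst ℝ ℝ ℝ + b • ContinuousLinearMap.snd ℝ ℝ ℝ))
    ((ContinuousLinearMap.fst ℝ ℝ ℝ).prod
      ((-a / b) • ContinuousLinearMap.fst ℝ ℝ ℝ + (1 / b) • ContinuousLinearMap.snd ℝ ℝ ℝ))
    (by intro p; ext <;> simp <;> field_simp <;> ring)
    (by intro p; ext <;> simp <;> field_simp <;> ring)

lemma shear_symm_apply (a b : ℝ) (hb : b ≠ 0) (u v : ℝ) :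
    (shear a b hb).symm (u, v) = (u, (-a / b) * u + (1 / b) * v) := rfl

lemma shear_apply (a b : ℝ) (hb : b ≠ 0) (u v : ℝ) :
    (shear a b hb) (u, v) = (u, a * u + b * v) := rfl

/-- Basic data of a twist map: `F` and its inverse `G`, the solution `Y x x'` of
`F₁ (x, Y x x') = x'`, and the primitive `Sg`. -/
structure TM (F G : Pl → Pl) (Y : ℝ → ℝ → ℝ) (Sg : Pl → ℝ) : Prop where
  cF : ContDiff ℝ 1 F
  cG : ContDiff ℝ 1 G
  GF : ∀ p, G (F p) = p
  FG : ∀ p, F (G p) = p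
  per : ∀ p, F (p + (1, 0)) = F p + (1, 0)
  mono : ∀ x, StrictMono fun y => (F (x, y)).1
  tw : ∀ p, 0 < (fderiv ℝ F p (0, 1)).1
  hY : ∀ x x', (F (x, Y x x')).1 = x'
  cS : ContDiff ℝ 1 Sg
  perS : ∀ p, Sg (p + (1, 0)) = Sg p
  dS : ∀ p : Pl,
      fderiv ℝ Sg p (1, 0) = (F p).2 * (fderiv ℝ F p (1, 0)).1 - p.2 ∧
      fderiv ℝ Sg p (0, 1) = (F p).2 * (fderiv ℝ F p (0, 1)).1

namespace TM
variable {F G : Pl → Pl} {Y : ℝ → ℝ → ℝ} {Sg : Pl → ℝ} (T : TM F G Y Sg)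
include T

lemma dF (p : Pl) : HasStrictFDerivAt F (fderiv ℝ F p) p :=
  T.cF.contDiffAt.hasStrictFDerivAt (by simp)

lemma Y_unique {x x' y : ℝ} (h : (F (x, y)).1 = x') : y = Y x x' :=
  (T.mono x).injective (by simp only [h, T.hY])

lemma Y_F (x y : ℝ) : Y x (F (x, y)).1 = y := (T.Y_unique rfl).symm

lemma Y_strict (x : ℝ) : StrictMono (Y x) := by
  intro a b hab
  by_contra hcon
  push Not at hcon
  have := (T.mono x).monotone hcon
  simp only [T.hY] at this
  linarith

lemma Y_per (x x' : ℝ) : Y (x + 1) (x' + 1) = Y x x' := by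
  symm
  apply T.Y_unique
  have := T.per (x, Y x x')
  simp only [Prod.mk_add_mk, add_zero] at this
  rw [this]; simp [T.hY]

lemma dPsi (p : Pl) : HasStrictFDerivAt (fun q : Pl => ((q.1, Y q.1 q.2) : Pl))
    ((shear (fderiv ℝ F p (1, 0)).1 (fderiv ℝ F p (0, 1)).1 (T.tw p).ne').symm : Pl →L[ℝ] Pl)
    (p.1, (F p).1) := by
  have h1 : HasStrictFDerivAt (fun q : Pl => ((q.1, (F q).1) : Pl))
      ((shear (fderiv ℝ F p (1, 0)).1 (fderiv ℝ F p (0, 1)).1 (T.tw p).ne') : Pl →L[ℝ] Pl) p := by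
    have := (hasStrictFDerivAt_fst (𝕜 := ℝ) (p := p)).prodMk (T.dF p).fst
    refine this.congr_fderiv (ContinuousLinearMap.ext ?_)
    rintro ⟨u, v⟩
    have e := lin_apply (fderiv ℝ F p) u v
    simp only [ContinuousLinearMap.prod_apply, ContinuousLinearMap.comp_apply,
      ContinuousLinearMap.coe_fst', e]
    simp [shear_apply, mul_comm]
  apply h1.to_local_left_inverse (g := (fun q : Pl => ((q.1, Y q.1 q.2) : Pl)))
  filter_upwards with q
  simp only [Prod.mk.eta, T.Y_F]

lemma dPsi' (q : Pl) : HasStrictFDerivAt (fun q : Pl => ((q.1, Y q.1 q.2) : Pl))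
    ((shear (fderiv ℝ F (q.1, Y q.1 q.2) (1, 0)).1 (fderiv ℝ F (q.1, Y q.1 q.2) (0, 1)).1
      (T.tw _).ne').symm : Pl →L[ℝ] Pl) q := by
  have := T.dPsi (q.1, Y q.1 q.2)
  simp only [T.hY] at this
  exact this

lemma cPsi : Continuous (fun q : Pl => ((q.1, Y q.1 q.2) : Pl)) :=
  continuous_iff_continuousAt.2 fun q => (T.dPsi' q).continuousAt

lemma cY : Continuous (fun q : Pl => Y q.1 q.2) := T.cPsi.snd

/-- the generating function -/
lemma dh (q : Pl) : HasFDerivAt (fun q : Pl => Sg (q.1, Y q.1 q.2))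
    ((-(Y q.1 q.2)) • ContinuousLinearMap.fst ℝ ℝ ℝ +
      (F (q.1, Y q.1 q.2)).2 • ContinuousLinearMap.snd ℝ ℝ ℝ) q := by
  have h1 : HasFDerivAt Sg (fderiv ℝ Sg (q.1, Y q.1 q.2)) (q.1, Y q.1 q.2) :=
    (T.cS.differentiable (by simp) _).hasFDerivAt
  have h2 := h1.comp q (T.dPsi' q).hasFDerivAt
  refine h2.congr_fderiv ?_
  have hb := (T.tw (q.1, Y q.1 q.2)).ne'
  obtain ⟨e1, e2⟩ := T.dS (q.1, Y q.1 q.2)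
  ext
  · simp [shear_symm_apply]
    rw [lin_apply, e1, e2]; simp; field_simp; ring
  · simp [shear_symm_apply]
    rw [lin_apply, e1, e2]; simp; field_simp

lemma det (p : Pl) : (fderiv ℝ F p (1, 0)).1 * (fderiv ℝ F p (0, 1)).2 -
    (fderiv ℝ F p (0, 1)).1 * (fderiv ℝ F p (1, 0)).2 = 1 := by
  set q : Pl := (p.1, (F p).1) with hq
  have hp : (q.1, Y q.1 q.2) = p := by simp [hq, T.Y_F]
  have hb := (T.tw p).ne'
  have d1 := (T.dPsi p).hasFDerivAt
  have d2 : HasFDerivAt (fun q : Pl => F (q.1, Y q.1 q.2)) _ q :=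
    HasFDerivAt.comp q (by rw [hp]; exact (T.dF p).hasFDerivAt) d1
  have d3 := ((d1.snd.neg.smul_const (ContinuousLinearMap.fst ℝ ℝ ℝ)).add
    (d2.snd.smul_const (ContinuousLinearMap.snd ℝ ℝ ℝ)))
  have := second_derivative_symmetric T.dh d3 (1, 0) (0, 1)
  simp [shear_symm_apply] at this
  rw [lin_apply] at this
  simp at this
  field_simp at this
  linarith

lemma detG (q : Pl) : (fderiv ℝ G q (0, 1)).1 = - (fderiv ℝ F (G q) (0, 1)).1 := by
  have h1 : HasFDerivAt F (fderiv ℝ F (G q)) (G q) := (T.dF _).hasFDerivAt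
  have h2 : HasFDerivAt G (fderiv ℝ G q) q := (T.cG.differentiable (by simp) _).hasFDerivAt
  have h3 := h1.comp q h2
  have h4 : F ∘ G = id := funext T.FG
  rw [h4] at h3
  have h5 := h3.unique (hasFDerivAt_id q)
  have h6 := congrArg (fun L : Pl →L[ℝ] Pl => L (0, 1)) h5
  simp only [ContinuousLinearMap.comp_apply, ContinuousLinearMap.id_apply] at h6
  have hd := T.det (G q)
  rw [← Prod.mk.eta (p := fderiv ℝ G q (0, 1)), lin_apply] at h6
  have h7 := congrArg Prod.fst h6
  have h8 := congrArg Prod.snd h6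
  simp only [Prod.fst_add, Prod.smul_fst, Prod.snd_add, Prod.smul_snd, smul_eq_mul] at h7 h8
  set A := (fderiv ℝ F (G q) (1, 0)).1
  set B := (fderiv ℝ F (G q) (0, 1)).1
  set C := (fderiv ℝ F (G q) (1, 0)).2
  set D := (fderiv ℝ F (G q) (0, 1)).2
  linear_combination D * h7 - B * h8 - (fderiv ℝ G q (0, 1)).1 * hd

/-- the inverse is a negative twist map -/
lemma antiG (x : ℝ) : StrictAnti fun y => (G (x, y)).1 := by
  apply strictAnti_of_deriv_neg
  intro y
  have h2 : HasFDerivAt G (fderiv ℝ G (x, y)) (x, y) :=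
    (T.cG.differentiable (by simp) _).hasFDerivAt
  have h3 : HasDerivAt (fun y : ℝ => ((x, y) : Pl)) (0, 1) y :=
    (hasDerivAt_const y x).prodMk (hasDerivAt_id y)
  have h4 : HasDerivAt (fun y => (G (x, y)).1) (fderiv ℝ G (x, y) (0, 1)).1 y :=
    (ContinuousLinearMap.fst ℝ ℝ ℝ).hasFDerivAt.comp_hasDerivAt y (h2.comp_hasDerivAt y h3)
  rw [h4.deriv, T.detG]
  linarith [T.tw (G (x, y))]

lemma fwd {p q : Pl} (h1 : p.1 = q.1) (h2 : p.2 < q.2) : (F p).1 < (F q).1 := by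
  obtain ⟨a, b⟩ := p
  obtain ⟨c, d⟩ := q
  simp only at h1 h2
  subst h1
  exact T.mono a h2

lemma bwd {p q : Pl} (h1 : (F p).1 = (F q).1) (h2 : (F p).2 < (F q).2) : q.1 < p.1 := by
  have := T.antiG (F p).1 h2
  simp only [Prod.mk.eta, T.GF] at this
  rw [h1] at this
  simpa [T.GF] using this

end TM
end CS

namespace CS

/-- entries of the derivative of the iterates -/
def aa (F : Pl → Pl) (n : ℕ) (p : Pl) : ℝ := (fderiv ℝ (F^[n]) p (0, 1)).1
def bb (F : Pl → Pl) (n : ℕ) (p : Pl) : ℝ := (fderiv ℝ (F^[n]) p (0, 1)).2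
def cc (F : Pl → Pl) (n : ℕ) (p : Pl) : ℝ := (fderiv ℝ (F^[n]) p (1, 0)).1
def dd (F : Pl → Pl) (n : ℕ) (p : Pl) : ℝ := (fderiv ℝ (F^[n]) p (1, 0)).2

namespace TM
variable {F G : Pl → Pl} {Y : ℝ → ℝ → ℝ} {Sg : Pl → ℝ} (T : TM F G Y Sg)
include T

lemma perN (n : ℕ) (p : Pl) : F (p + ((n : ℝ), 0)) = F p + ((n : ℝ), 0) := by
  induction n with
  | zero => simp [← Prod.zero_eq_mk]
  | succ n ih =>
    have : p + (((n + 1 : ℕ) : ℝ), (0:ℝ)) = (p + ((n : ℝ), 0)) + (1, 0) := by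
      ext <;> simp [add_assoc]
    rw [this, T.per, ih]
    ext <;> simp [add_assoc]

lemma perZ (k : ℤ) (p : Pl) : F (p + ((k : ℝ), 0)) = F p + ((k : ℝ), 0) := by
  obtain ⟨n, rfl | rfl⟩ := k.eq_nat_or_neg
  · exact_mod_cast T.perN n p
  · have := T.perN n (p + (((-(n:ℤ) : ℤ) : ℝ), 0))
    have e : p + (((-(n:ℤ) : ℤ) : ℝ), (0:ℝ)) + ((n : ℝ), 0) = p := by
      ext <;> simp
    rw [e] at this
    rw [this]
    ext <;> simp

lemma perGZ (k : ℤ) (p : Pl) : G (p + ((k : ℝ), 0)) = G p + ((k : ℝ), 0) := by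
  have := T.perZ k (G p)
  rw [T.FG] at this
  rw [← this, T.GF]

lemma perIter (k : ℤ) (n : ℕ) (p : Pl) : F^[n] (p + ((k : ℝ), 0)) = F^[n] p + ((k : ℝ), 0) := by
  induction n with
  | zero => rfl
  | succ n ih => rw [iterate_succ_apply', ih, T.perZ, iterate_succ_apply']

lemma perGIter (k : ℤ) (n : ℕ) (p : Pl) :
    G^[n] (p + ((k : ℝ), 0)) = G^[n] p + ((k : ℝ), 0) := by
  induction n with
  | zero => rfl
  | succ n ih => rw [iterate_succ_apply', ih, T.perGZ, iterate_succ_apply']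

lemma Y_perZ (k : ℤ) (x x' : ℝ) : Y (x + k) (x' + k) = Y x x' := by
  symm
  apply T.Y_unique
  have := T.perZ k (x, Y x x')
  simp only [Prod.mk_add_mk, add_zero] at this
  rw [this]; simp [T.hY]

lemma contF : Continuous F := T.cF.continuous
lemma contG : Continuous G := T.cG.continuous

lemma GF_iter (n : ℕ) (p : Pl) : G^[n] (F^[n] p) = p :=
  LeftInverse.iterate (g := G) (f := F) T.GF n p

lemma FG_iter (n : ℕ) (p : Pl) : F^[n] (G^[n] p) = p :=
  LeftInverse.iterate (g := F) (f := G) T.FG n p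

lemma cFn (n : ℕ) : ContDiff ℝ 1 (F^[n]) := by
  induction n with
  | zero => exact contDiff_id
  | succ n ih => rw [iterate_succ]; exact ih.comp T.cF
lemma cGn (n : ℕ) : ContDiff ℝ 1 (G^[n]) := by
  induction n with
  | zero => exact contDiff_id
  | succ n ih => rw [iterate_succ]; exact ih.comp T.cG

lemma dFn (n : ℕ) (p : Pl) : HasFDerivAt (F^[n]) (fderiv ℝ (F^[n]) p) p :=
  ((T.cFn n).differentiable (by simp) p).hasFDerivAt

lemma chain (m n : ℕ) (p v : Pl) :
    fderiv ℝ (F^[m + n]) p v = fderiv ℝ (F^[m]) (F^[n] p) (fderiv ℝ (F^[n]) p v) := by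
  rw [iterate_add, ((T.dFn m (F^[n] p)).comp p (T.dFn n p)).fderiv]
  rfl

lemma aa_add (m n : ℕ) (p : Pl) :
    aa F (m + n) p = cc F m (F^[n] p) * aa F n p + aa F m (F^[n] p) * bb F n p := by
  unfold aa cc bb
  rw [T.chain, ← Prod.mk.eta (p := fderiv ℝ (F^[n]) p (0, 1)), lin_apply]
  simp [mul_comm]

lemma bb_add (m n : ℕ) (p : Pl) :
    bb F (m + n) p = dd F m (F^[n] p) * aa F n p + bb F m (F^[n] p) * bb F n p := by
  unfold aa dd bb
  rw [T.chain, ← Prod.mk.eta (p := fderiv ℝ (F^[n]) p (0, 1)), lin_apply]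
  simp [mul_comm]

lemma cc_add (m n : ℕ) (p : Pl) :
    cc F (m + n) p = cc F m (F^[n] p) * cc F n p + aa F m (F^[n] p) * dd F n p := by
  unfold aa cc dd
  rw [T.chain, ← Prod.mk.eta (p := fderiv ℝ (F^[n]) p (1, 0)), lin_apply]
  simp [mul_comm]

lemma dd_add (m n : ℕ) (p : Pl) :
    dd F (m + n) p = dd F m (F^[n] p) * cc F n p + bb F m (F^[n] p) * dd F n p := by
  unfold cc dd bb
  rw [T.chain, ← Prod.mk.eta (p := fderiv ℝ (F^[n]) p (1, 0)), lin_apply]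
  simp [mul_comm]

omit T in
lemma zero_vals (p : Pl) : aa F 0 p = 0 ∧ bb F 0 p = 1 ∧ cc F 0 p = 1 ∧ dd F 0 p = 0 := by
  simp [aa, bb, cc, dd]

lemma aa_one_pos (p : Pl) : 0 < aa F 1 p := by
  simpa [aa] using T.tw p

lemma det_iter (n : ℕ) (p : Pl) : cc F n p * bb F n p - aa F n p * dd F n p = 1 := by
  induction n with
  | zero => obtain ⟨h1, h2, h3, h4⟩ := zero_vals (F := F) p; rw [h1, h2, h3, h4]; norm_num
  | succ n ih =>
    rw [add_comm n 1, T.aa_add, T.bb_add, T.cc_add, T.dd_add]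
    have h := T.det (F^[n] p)
    have h' : cc F 1 (F^[n] p) * bb F 1 (F^[n] p) - aa F 1 (F^[n] p) * dd F 1 (F^[n] p) = 1 := by
      simpa [cc, bb, aa, dd] using h
    linear_combination h' * (cc F n p * bb F n p - aa F n p * dd F n p) + ih

lemma cont_aa (n : ℕ) : Continuous (aa F n) := by
  have := (T.cFn n).continuous_fderiv (by simp)
  exact (this.clm_apply continuous_const).fst

lemma hasDerivAt_iter (n : ℕ) (x y : ℝ) :
    HasDerivAt (fun y => F^[n] (x, y)) (fderiv ℝ (F^[n]) (x, y) (0, 1)) y := by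
  have h3 : HasDerivAt (fun y : ℝ => ((x, y) : Pl)) (0, 1) y :=
    (hasDerivAt_const y x).prodMk (hasDerivAt_id y)
  exact (T.dFn n (x, y)).comp_hasDerivAt y h3

lemma hasDerivAt_iter1 (n : ℕ) (x y : ℝ) :
    HasDerivAt (fun y => (F^[n] (x, y)).1) (aa F n (x, y)) y :=
  (ContinuousLinearMap.fst ℝ ℝ ℝ).hasFDerivAt.comp_hasDerivAt y (T.hasDerivAt_iter n x y)

lemma hasDerivAt_Giter1 (n : ℕ) (x y : ℝ) :
    HasDerivAt (fun y => (G^[n] (x, y)).1) (-aa F n (G^[n] (x, y))) y := by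
  have h3 : HasDerivAt (fun y : ℝ => ((x, y) : Pl)) (0, 1) y :=
    (hasDerivAt_const y x).prodMk (hasDerivAt_id y)
  have h2 : HasFDerivAt (G^[n]) (fderiv ℝ (G^[n]) (x, y)) (x, y) :=
    ((T.cGn n).differentiable (by simp) (x, y)).hasFDerivAt
  have h4 : HasDerivAt (fun y => (G^[n] (x, y)).1) (fderiv ℝ (G^[n]) (x, y) (0, 1)).1 y :=
    (ContinuousLinearMap.fst ℝ ℝ ℝ).hasFDerivAt.comp_hasDerivAt y (h2.comp_hasDerivAt y h3)
  convert h4 using 1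
  have h1 := T.dFn n (G^[n] (x, y))
  have h5 := h1.comp (x, y) h2
  have h6 : F^[n] ∘ G^[n] = id := funext (T.FG_iter n)
  rw [h6] at h5
  have h7 := congrArg (fun L : Pl →L[ℝ] Pl => L (0, 1)) (h5.unique (hasFDerivAt_id (x, y)))
  simp only [ContinuousLinearMap.comp_apply, ContinuousLinearMap.id_apply] at h7
  have hd := T.det_iter n (G^[n] (x, y))
  rw [← Prod.mk.eta (p := fderiv ℝ (G^[n]) (x, y) (0, 1)), lin_apply] at h7
  have h8 := congrArg Prod.fst h7
  have h9 := congrArg Prod.snd h7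
  simp only [Prod.fst_add, Prod.smul_fst, Prod.snd_add, Prod.smul_snd, smul_eq_mul] at h8 h9
  change _ * cc F n _ + _ * aa F n _ = 0 at h8
  change _ * dd F n _ + _ * bb F n _ = 1 at h9
  set A := cc F n (G^[n] (x, y))
  set B := aa F n (G^[n] (x, y))
  set C := dd F n (G^[n] (x, y))
  set D := bb F n (G^[n] (x, y))
  linear_combination -D * h8 + B * h9 + (fderiv ℝ (G^[n]) (x, y) (0, 1)).1 * hd

/-- confinement above an invariant graph -/
lemma above {ψ g : ℝ → ℝ} (hgm : StrictMono g) (hgs : Surjective g)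
    (hinv : ∀ x, F (x, ψ x) = (g x, ψ (g x))) {p : Pl} (hp : ψ p.1 < p.2) :
    g p.1 < (F p).1 ∧ ψ (F p).1 < (F p).2 := by
  have h1 : g p.1 < (F p).1 := by
    have := T.fwd (p := (p.1, ψ p.1)) (q := p) rfl hp
    rwa [hinv] at this
  refine ⟨h1, ?_⟩
  obtain ⟨x'', hx''⟩ := hgs (F p).1
  have h2 : p.1 < x'' := by rw [← hx''] at h1; exact hgm.lt_iff_lt.1 h1
  by_contra hcon
  push Not at hcon
  rcases hcon.lt_or_eq with h | h
  · have := T.bwd (p := p) (q := (x'', ψ x'')) (by rw [hinv, hx'']) (by rw [hinv, hx'']; exact h)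
    simp only at this
    linarith
  · have : F p = F (x'', ψ x'') := by
      rw [hinv, hx'']; exact Prod.ext rfl h
    have := congrArg (fun p => (G p).1) this
    simp only [T.GF] at this
    linarith

lemma below {ψ g : ℝ → ℝ} (hgm : StrictMono g) (hgs : Surjective g)
    (hinv : ∀ x, F (x, ψ x) = (g x, ψ (g x))) {p : Pl} (hp : p.2 < ψ p.1) :
    (F p).1 < g p.1 ∧ (F p).2 < ψ (F p).1 := by
  have h1 : (F p).1 < g p.1 := by
    have := T.fwd (p := p) (q := (p.1, ψ p.1)) rfl hp
    rwa [hinv] at this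
  refine ⟨h1, ?_⟩
  obtain ⟨x'', hx''⟩ := hgs (F p).1
  have h2 : x'' < p.1 := by rw [← hx''] at h1; exact hgm.lt_iff_lt.1 h1
  by_contra hcon
  push Not at hcon
  rcases hcon.lt_or_eq with h | h
  · have := T.bwd (p := (x'', ψ x'')) (q := p) (by rw [hinv, hx'']) (by rw [hinv, hx'']; exact h)
    simp only at this
    linarith
  · have : F p = F (x'', ψ x'') := by
      rw [hinv, hx'']; exact Prod.ext rfl h.symm
    have := congrArg (fun p => (G p).1) this
    simp only [T.GF] at this
    linarith

lemma iter_graph {ψ g : ℝ → ℝ} (hinv : ∀ x, F (x, ψ x) = (g x, ψ (g x))) (n : ℕ) (x : ℝ) :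
    F^[n] (x, ψ x) = (g^[n] x, ψ (g^[n] x)) := by
  induction n with
  | zero => rfl
  | succ n ih => rw [iterate_succ_apply', ih, hinv, iterate_succ_apply']

lemma above_iter {ψ g : ℝ → ℝ} (hgm : StrictMono g) (hgs : Surjective g)
    (hinv : ∀ x, F (x, ψ x) = (g x, ψ (g x))) {p : Pl} (hp : ψ p.1 < p.2) (n : ℕ) :
    g^[n] p.1 ≤ (F^[n] p).1 ∧ (1 ≤ n → g^[n] p.1 < (F^[n] p).1) ∧
      ψ (F^[n] p).1 < (F^[n] p).2 := by
  induction n with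
  | zero => simpa using hp
  | succ n ih =>
    obtain ⟨h1, -, h3⟩ := ih
    obtain ⟨h4, h5⟩ := T.above hgm hgs hinv h3
    rw [iterate_succ_apply', iterate_succ_apply']
    have h6 : g (g^[n] p.1) < (F (F^[n] p)).1 := (hgm.monotone h1).trans_lt h4
    exact ⟨h6.le, fun _ => h6, h5⟩

end TM
end CS

namespace CS

lemma periodic_bdd {φ : ℝ → ℝ} (hc : Continuous φ) (hp : ∀ x, φ (x + 1) = φ x) :
    ∃ B, ∀ x, |φ x| ≤ B := by
  have h1 : Periodic φ 1 := hp
  obtain ⟨B, hB⟩ := (h1.compact_of_continuous one_ne_zero hc).isBounded.exists_norm_le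
  exact ⟨B, fun x => hB _ (mem_range_self x)⟩

namespace TM
variable {F G : Pl → Pl} {Y : ℝ → ℝ → ℝ} {Sg : Pl → ℝ} (T : TM F G Y Sg)
include T

lemma Y_bdd (M : ℝ) : ∃ B, ∀ x, |Y x (x + M)| ≤ B := by
  apply periodic_bdd (φ := fun x => Y x (x + M))
  · exact T.cY.comp (continuous_id.prodMk (continuous_id.add continuous_const))
  · intro x
    have : x + 1 + M = (x + M) + 1 := by ring
    rw [this, T.Y_per]

lemma G_bdd (M : ℝ) : ∃ B, ∀ x, |(G (x, M)).1 - x| ≤ B := by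
  apply periodic_bdd (φ := fun x => (G (x, M)).1 - x)
  · exact (T.contG.comp (continuous_id.prodMk continuous_const)).fst.sub continuous_id
  · intro x
    have := T.perGZ 1 (x, M)
    simp only [Int.cast_one, Prod.mk_add_mk, add_zero] at this
    rw [this]; simp

lemma E1 (M : ℝ) : ∃ R, ∀ p : Pl, R ≤ p.2 → p.1 + M ≤ (F p).1 := by
  obtain ⟨B, hB⟩ := T.Y_bdd M
  refine ⟨B, fun p hp => ?_⟩
  have := (T.mono p.1).monotone ((le_of_abs_le (hB p.1)).trans hp)
  simpa only [T.hY] using this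

lemma E1' (M : ℝ) : ∃ R, ∀ p : Pl, p.2 ≤ -R → (F p).1 ≤ p.1 - M := by
  obtain ⟨B, hB⟩ := T.Y_bdd (-M)
  refine ⟨B, fun p hp => ?_⟩
  have := (T.mono p.1).monotone (hp.trans (neg_le_of_abs_le (hB p.1)))
  simpa only [T.hY, ← sub_eq_add_neg] using this

lemma E2 (M : ℝ) : ∃ R, ∀ p : Pl, R ≤ p.2 → M ≤ (F p).2 := by
  obtain ⟨B, hB⟩ := T.G_bdd M
  obtain ⟨R, hR⟩ := T.E1 (B + 1)
  refine ⟨R, fun p hp => ?_⟩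
  by_contra hcon
  push Not at hcon
  have h1 := T.antiG (F p).1 hcon
  simp only [Prod.mk.eta, T.GF] at h1
  have h2 := hR p hp
  have h3 := neg_le_of_abs_le (hB (F p).1)
  linarith

lemma E2' (M : ℝ) : ∃ R, ∀ p : Pl, p.2 ≤ -R → (F p).2 ≤ -M := by
  obtain ⟨B, hB⟩ := T.G_bdd (-M)
  obtain ⟨R, hR⟩ := T.E1' (B + 1)
  refine ⟨R, fun p hp => ?_⟩
  by_contra hcon
  push Not at hcon
  have h1 := T.antiG (F p).1 hcon
  simp only [Prod.mk.eta, T.GF] at h1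
  have h2 := hR p hp
  have h3 := le_of_abs_le (hB (F p).1)
  linarith

lemma E3 (n : ℕ) : ∀ M, ∃ R, ∀ p : Pl, R ≤ p.2 →
    M ≤ (F^[n] p).2 ∧ p.1 ≤ (F^[n] p).1 ∧ (1 ≤ n → p.1 + M ≤ (F^[n] p).1) := by
  induction n with
  | zero => intro M; exact ⟨M, fun p hp => ⟨hp, le_rfl, by simp⟩⟩
  | succ n ih =>
    intro M
    obtain ⟨R1, h1⟩ := T.E1 (max M 0)
    obtain ⟨R2, h2⟩ := T.E2 M
    obtain ⟨R, h3⟩ := ih (max R1 R2)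
    refine ⟨R, fun p hp => ?_⟩
    obtain ⟨h4, h5, -⟩ := h3 p hp
    have h6 := h1 _ ((le_max_left _ _).trans h4)
    have h7 := h2 _ ((le_max_right _ _).trans h4)
    rw [iterate_succ_apply']
    have := le_max_left M 0
    have := le_max_right M 0
    exact ⟨h7, by linarith, fun _ => by linarith⟩

lemma E3' (n : ℕ) : ∀ M, ∃ R, ∀ p : Pl, p.2 ≤ -R →
    (F^[n] p).2 ≤ -M ∧ (F^[n] p).1 ≤ p.1 ∧ (1 ≤ n → (F^[n] p).1 ≤ p.1 - M) := by
  induction n with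
  | zero => intro M; exact ⟨M, fun p hp => ⟨hp, le_rfl, by simp⟩⟩
  | succ n ih =>
    intro M
    obtain ⟨R1, h1⟩ := T.E1' (max M 0)
    obtain ⟨R2, h2⟩ := T.E2' M
    obtain ⟨R, h3⟩ := ih (max R1 R2)
    refine ⟨R, fun p hp => ?_⟩
    obtain ⟨h4, h5, -⟩ := h3 p hp
    have := le_max_left R1 R2
    have := le_max_right R1 R2
    have h6 := h1 (F^[n] p) (by linarith)
    have h7 := h2 (F^[n] p) (by linarith)
    rw [iterate_succ_apply']
    have := le_max_left M 0
    have := le_max_right M 0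
    exact ⟨h7, by linarith, fun _ => by linarith⟩

lemma cont1 (n : ℕ) (x : ℝ) : Continuous fun y => (F^[n] (x, y)).1 :=
  continuous_iff_continuousAt.2 fun y => (T.hasDerivAt_iter1 n x y).continuousAt

lemma surj_iter {n : ℕ} (hn : 1 ≤ n) (x : ℝ) : Surjective fun y => (F^[n] (x, y)).1 := by
  intro u
  obtain ⟨R, hR⟩ := T.E3 n (u - x)
  obtain ⟨R', hR'⟩ := T.E3' n (x - u)
  have h1 := (hR (x, R) le_rfl).2.2 hn
  have h2 := (hR' (x, -R') le_rfl).2.2 hn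
  simp only at h1 h2
  exact mem_range_of_exists_le_of_exists_ge (T.cont1 n x) ⟨-R', by linarith⟩ ⟨R, by linarith⟩

variable (hN : ∀ p : Pl, ∀ n : ℕ, 1 ≤ n → aa F n p ≠ 0)
include hN

lemma aa_pos {n : ℕ} (hn : 1 ≤ n) (p : Pl) : 0 < aa F n p := by
  obtain ⟨x, y⟩ := p
  rcases hasDerivWithinAt_forall_lt_or_forall_gt_of_forall_ne (s := univ) convex_univ
    (fun y _ => (T.hasDerivAt_iter1 n x y).hasDerivWithinAt) (fun y _ => hN (x, y) n hn) with h | h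
  · exfalso
    have hanti : StrictAnti fun y => (F^[n] (x, y)).1 := by
      apply strictAnti_of_deriv_neg
      intro y
      rw [(T.hasDerivAt_iter1 n x y).deriv]
      exact h y (mem_univ _)
    obtain ⟨R, hR⟩ := T.E3 n 1
    obtain ⟨R', hR'⟩ := T.E3' n 1
    have h1 := (hR (x, max R (-R')) (le_max_left _ _)).2.2 hn
    have h2 := (hR' (x, -R') le_rfl).2.2 hn
    have h3 := hanti.antitone (le_max_right R (-R'))
    simp only at h1 h2 h3
    linarith
  · exact h y (mem_univ _)

lemma mono_iter {n : ℕ} (hn : 1 ≤ n) (x : ℝ) : StrictMono fun y => (F^[n] (x, y)).1 := by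
  apply strictMono_of_deriv_pos
  intro y
  rw [(T.hasDerivAt_iter1 n x y).deriv]
  exact T.aa_pos hN hn _

lemma anti_Giter {n : ℕ} (hn : 1 ≤ n) (x : ℝ) : StrictAnti fun y => (G^[n] (x, y)).1 := by
  apply strictAnti_of_deriv_neg
  intro y
  rw [(T.hasDerivAt_Giter1 n x y).deriv]
  linarith [T.aa_pos hN hn (G^[n] (x, y))]

omit hN in
lemma hasDerivAt_S (n : ℕ) (x y : ℝ) :
    HasDerivAt (fun y => ∑ i ∈ Finset.range n, Sg (F^[i] (x, y)))
      ((F^[n] (x, y)).2 * aa F n (x, y)) y := by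
  induction n with
  | zero => simpa [(zero_vals (F := F) (x, y)).1] using hasDerivAt_const y (0:ℝ)
  | succ n ih =>
    simp only [Finset.sum_range_succ]
    have h1 : HasFDerivAt Sg (fderiv ℝ Sg (F^[n] (x, y))) (F^[n] (x, y)) :=
      (T.cS.differentiable (by simp) _).hasFDerivAt
    have h2 : HasDerivAt (fun y => Sg (F^[n] (x, y)))
      (fderiv ℝ Sg (F^[n] (x, y)) (fderiv ℝ (F^[n]) (x, y) (0, 1))) y :=
      h1.comp_hasDerivAt y (T.hasDerivAt_iter n x y)
    refine (ih.add h2).congr_deriv ?_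
    symm
    obtain ⟨e1, e2⟩ := T.dS (F^[n] (x, y))
    rw [← Prod.mk.eta (p := fderiv ℝ (F^[n]) (x, y) (0, 1)), lin_apply, e1, e2, add_comm n 1,
      T.aa_add, add_comm 1 n, iterate_succ_apply']
    simp only [smul_eq_mul, aa, bb, cc, iterate_one]
    ring

lemma step {n : ℕ} (hn : 1 ≤ n) (x y y' : ℝ) :
    ∑ i ∈ Finset.range (n + 1), Sg (F^[i] (x, y')) ≤
      ∑ i ∈ Finset.range n, Sg (F^[i] (x, y)) +
      Sg ((F^[n] (x, y)).1, Y (F^[n] (x, y)).1 (F^[n + 1] (x, y')).1) := by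
  set x'' := (F^[n + 1] (x, y')).1 with hx''
  set φ : ℝ → ℝ := fun y => ∑ i ∈ Finset.range n, Sg (F^[i] (x, y)) +
      Sg ((F^[n] (x, y)).1, Y (F^[n] (x, y)).1 x'') with hφ
  have hd : ∀ y, HasDerivAt φ
      (aa F n (x, y) * ((F^[n] (x, y)).2 - Y (F^[n] (x, y)).1 x'')) y := by
    intro y
    have h1 := T.hasDerivAt_S n x y
    have h2 := T.dh ((F^[n] (x, y)).1, x'')
    have h3 : HasDerivAt (fun y => (((F^[n] (x, y)).1, x'') : Pl)) (aa F n (x, y), 0) y :=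
      (T.hasDerivAt_iter1 n x y).prodMk (hasDerivAt_const y x'')
    have h4 := h1.add (h2.comp_hasDerivAt y h3)
    refine h4.congr_deriv ?_
    simp
    ring
  have hcont : Continuous φ := continuous_iff_continuousAt.2 fun y => (hd y).continuousAt
  have hcmp : ∀ y, (F^[n + 1] (x, y)).1 = (F ((F^[n] (x, y)).1, (F^[n] (x, y)).2)).1 := by
    intro y; rw [iterate_succ_apply']
  have hm := T.mono_iter hN (n := n + 1) (by omega) x
  have hval : φ y' = ∑ i ∈ Finset.range (n + 1), Sg (F^[i] (x, y')) := by
    rw [Finset.sum_range_succ]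
    simp only [hφ, hx'', iterate_succ_apply']
    have := T.Y_F (F^[n] (x, y')).1 (F^[n] (x, y')).2
    simp only [Prod.mk.eta] at this
    rw [this]
  rw [← hval]
  change φ y' ≤ φ y
  rcases le_total y' y with h | h
  · have : MonotoneOn φ (Ici y') := by
      apply monotoneOn_of_deriv_nonneg (convex_Ici y') hcont.continuousOn
        (fun u _ => (hd u).differentiableAt.differentiableWithinAt)
      intro u hu
      rw [interior_Ici] at hu
      rw [(hd u).deriv]
      apply mul_nonneg (T.aa_pos hN hn _).le
      have h1 := hm hu
      simp only at h1
      rw [← hx'', hcmp, ← T.hY (F^[n] (x, u)).1 x''] at h1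
      have := (T.mono (F^[n] (x, u)).1).lt_iff_lt.1 h1
      linarith
    exact this (mem_Ici.2 le_rfl) h h
  · have : AntitoneOn φ (Iic y') := by
      apply antitoneOn_of_deriv_nonpos (convex_Iic y') hcont.continuousOn
        (fun u _ => (hd u).differentiableAt.differentiableWithinAt)
      intro u hu
      rw [interior_Iic] at hu
      rw [(hd u).deriv]
      apply mul_nonpos_of_nonneg_of_nonpos (T.aa_pos hN hn _).le
      have h1 := hm hu
      simp only at h1
      rw [← hx'', hcmp, ← T.hY (F^[n] (x, u)).1 x''] at h1
      have := (T.mono (F^[n] (x, u)).1).lt_iff_lt.1 h1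
      linarith
    exact this h (mem_Iic.2 le_rfl) h

omit hN in
lemma h_perZ (k : ℤ) (x x' : ℝ) : Sg (x + k, Y (x + k) (x' + k)) = Sg (x, Y x x') := by
  rw [T.Y_perZ]
  have hper : ∀ y, Periodic (fun x => Sg (x, y)) 1 := by
    intro y x
    have := T.perS (x, y)
    simpa using this
  have := (hper (Y x x')).int_mul k x
  simpa using this

lemma min_chain (p : ℤ) (xM xm : ℝ) (m : ℕ) (y : ℝ)
    (hy : (F^[m + 1] (xM, y)).1 = xm + (((m + 1 : ℕ) * p : ℤ) : ℝ)) :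
    ∑ i ∈ Finset.range (m + 1), Sg (F^[i] (xM, y)) ≤
      Sg (xM, Y xM (xm + p)) + m * Sg (xm, Y xm (xm + p)) := by
  induction m generalizing y with
  | zero =>
    simp at hy
    simp [← hy, T.Y_F]
  | succ m ih =>
    obtain ⟨y', hy'⟩ := T.surj_iter (n := m + 1) (by omega) xM
      (xm + (((m + 1 : ℕ) * p : ℤ) : ℝ))
    have h1 := ih y' hy'
    have h2 := T.step hN (n := m + 1) (by omega) xM y' y
    simp only at hy'
    rw [hy, hy'] at h2
    have h3 := T.h_perZ ((m + 1 : ℕ) * p) xm (xm + p)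
    have e : xm + (p:ℝ) + (((m + 1 : ℕ) * p : ℤ) : ℝ) = xm + (((m + 1 + 1 : ℕ) * p : ℤ) : ℝ) := by
      push_cast; ring
    rw [e] at h3
    rw [h3] at h2
    push_cast
    linarith

lemma psi_inv (p : ℤ) (x : ℝ) : F (x, Y x (x + p)) = (x + p, Y x (x + p)) := by
  set A : ℝ → ℝ := fun x => Sg (x, Y x (x + p)) with hA
  have hd : ∀ x, HasDerivAt A (-(Y x (x + p)) + (F (x, Y x (x + p))).2) x := by
    intro x
    have h3 : HasDerivAt (fun x : ℝ => ((x, x + p) : Pl)) (1, 1) x :=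
      (hasDerivAt_id x).prodMk ((hasDerivAt_id x).add_const _)
    have := (T.dh (x, x + p)).comp_hasDerivAt x h3
    refine this.congr_deriv ?_
    simp
  have hcont : Continuous A := continuous_iff_continuousAt.2 fun y => (hd y).continuousAt
  have hper : Periodic A 1 := by
    intro x
    have := T.h_perZ 1 x (x + p)
    simp only [Int.cast_one] at this
    simp only [hA]
    rw [← this]
    congr 3
    ring
  have hcpt := hper.compact_of_continuous one_ne_zero hcont
  obtain ⟨_, ⟨xM, rfl⟩, hM⟩ := hcpt.exists_isGreatest (range_nonempty A)
  obtain ⟨_, ⟨xm, rfl⟩, hm⟩ := hcpt.exists_isLeast (range_nonempty A)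
  have hM' : ∀ x, A x ≤ A xM := fun x => hM (mem_range_self x)
  have hm' : ∀ x, A xm ≤ A x := fun x => hm (mem_range_self x)
  have crit : ∀ x, (∀ u, A u ≤ A x) → F (x, Y x (x + p)) = (x + p, Y x (x + p)) := by
    intro x hx
    have h1 : IsLocalMax A x := Eventually.of_forall hx
    have h2 := h1.hasDerivAt_eq_zero (hd x)
    exact Prod.ext (T.hY _ _) (by simp only; linarith)
  have horb : ∀ n : ℕ, F^[n] (xM, Y xM (xM + p)) = (xM + ((n * p : ℤ) : ℝ), Y xM (xM + p)) := by
    intro n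
    induction n with
    | zero => simp
    | succ n ih =>
      rw [iterate_succ_apply', ih]
      have := T.perZ (n * p) (xM, Y xM (xM + p))
      rw [crit xM hM'] at this
      simp only [Prod.mk_add_mk, add_zero] at this
      rw [this]
      congr 1
      push_cast; ring
  have hact : ∀ n : ℕ, ∑ i ∈ Finset.range n, Sg (F^[i] (xM, Y xM (xM + p))) = n * A xM := by
    intro n
    have : ∀ i ∈ Finset.range n, Sg (F^[i] (xM, Y xM (xM + p))) = A xM := by
      intro i _
      rw [horb]
      have := T.h_perZ (i * p) xM (xM + p)
      rwa [T.Y_perZ] at this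
    rw [Finset.sum_congr rfl this]
    simp
  have key : ∀ m : ℕ, ((m + 1 + 1 : ℕ) : ℝ) * A xM ≤ Sg (xM, Y xM (xm + p)) + m * A xm +
      Sg (xm, Y xm (xM + p)) := by
    intro m
    obtain ⟨y, hy⟩ := T.surj_iter (n := m + 1) (by omega) xM (xm + (((m + 1 : ℕ) * p : ℤ) : ℝ))
    have h1 := T.min_chain hN p xM xm m y hy
    have h2 := T.step hN (n := m + 1) (by omega) xM y (Y xM (xM + p))
    simp only at hy
    rw [hact, hy, horb] at h2
    have h3 := T.h_perZ ((m + 1 : ℕ) * p) xm (xM + p)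
    have e : xM + (p:ℝ) + (((m + 1 : ℕ) * p : ℤ) : ℝ) = xM + (((m + 1 + 1 : ℕ) * p : ℤ) : ℝ) := by
      push_cast; ring
    rw [e] at h3
    rw [h3] at h2
    linarith
  have hle : A xM ≤ A xm := by
    by_contra hcon
    push Not at hcon
    obtain ⟨m, hm⟩ := exists_nat_gt ((Sg (xM, Y xM (xm + p)) + Sg (xm, Y xm (xM + p)) - 2 * A xM)
      / (A xM - A xm))
    rw [div_lt_iff₀ (by linarith)] at hm
    have := key m
    push_cast at this
    nlinarith
  exact crit x fun u => by linarith [hM' u, hm' x]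

end TM
end CS

namespace CS

/-- two orbits stay at bounded horizontal distance -/
def Rel (F : Pl → Pl) (z w : Pl) : Prop := ∃ R : ℝ, ∀ n : ℕ, |(F^[n] z).1 - (F^[n] w).1| ≤ R

lemma Rel.symm {F : Pl → Pl} {z w : Pl} (h : Rel F z w) : Rel F w z := by
  obtain ⟨R, hR⟩ := h
  exact ⟨R, fun n => by rw [abs_sub_comm]; exact hR n⟩

lemma Rel.trans {F : Pl → Pl} {z w u : Pl} (h : Rel F z w) (h' : Rel F w u) : Rel F z u := by
  obtain ⟨R, hR⟩ := h
  obtain ⟨R', hR'⟩ := h'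
  exact ⟨R + R', fun n => (abs_sub_le _ _ _).trans (add_le_add (hR n) (hR' n))⟩

lemma Rel.map {F : Pl → Pl} {z w : Pl} (h : Rel F z w) : Rel F (F z) (F w) := by
  obtain ⟨R, hR⟩ := h
  exact ⟨R, fun n => by
    rw [← iterate_succ_apply, ← iterate_succ_apply]; exact hR (n + 1)⟩

namespace TM
variable {F G : Pl → Pl} {Y : ℝ → ℝ → ℝ} {Sg : Pl → ℝ} (T : TM F G Y Sg)
include T

lemma aa_per (n : ℕ) (k : ℤ) (p : Pl) : aa F n (p + ((k : ℝ), 0)) = aa F n p := by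
  unfold aa
  have h : (fun q => F^[n] (q + ((k : ℝ), (0:ℝ)))) = fun q => F^[n] q + ((k : ℝ), (0:ℝ)) :=
    funext fun q => T.perIter k n q
  rw [← fderiv_comp_add_right, h, fderiv_add_const]

/-- lower bound for the twist on strips -/
lemma twist_lower (k : ℝ) : ∃ β > 0, ∀ q : Pl, k ≤ (F q).1 - q.1 → (F q).1 - q.1 ≤ k + 1 →
    β ≤ aa F 1 q := by
  obtain ⟨B1, hB1⟩ := T.Y_bdd k
  obtain ⟨B2, hB2⟩ := T.Y_bdd (k + 1)
  set C : Set Pl := Icc (0:ℝ) 1 ×ˢ Icc (-B1) B2 with hC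
  have hcpt : IsCompact C := isCompact_Icc.prod isCompact_Icc
  have hex : ∃ β > 0, ∀ q ∈ C, β ≤ aa F 1 q := by
    rcases C.eq_empty_or_nonempty with h | h
    · exact ⟨1, one_pos, by simp [h]⟩
    · obtain ⟨q0, -, hq0⟩ := hcpt.exists_isMinOn h (T.cont_aa 1).continuousOn
      exact ⟨aa F 1 q0, T.aa_one_pos q0, fun q hq => hq0 hq⟩
  obtain ⟨β, hβ, h⟩ := hex
  refine ⟨β, hβ, fun q h1 h2 => ?_⟩
  have h3 : Y q.1 (q.1 + k) ≤ q.2 := by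
    have : (F (q.1, Y q.1 (q.1 + k))).1 ≤ (F (q.1, q.2)).1 := by
      rw [T.hY]; simp only [Prod.mk.eta]; linarith
    exact (T.mono q.1).le_iff_le.1 this
  have h4 : q.2 ≤ Y q.1 (q.1 + (k + 1)) := by
    have : (F (q.1, q.2)).1 ≤ (F (q.1, Y q.1 (q.1 + (k + 1)))).1 := by
      rw [T.hY]; simp only [Prod.mk.eta]; linarith
    exact (T.mono q.1).le_iff_le.1 this
  have h5 := neg_le_of_abs_le (hB1 q.1)
  have h6 := le_of_abs_le (hB2 q.1)
  rw [← T.aa_per 1 (-⌊q.1⌋) q]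
  apply h
  refine ⟨⟨?_, ?_⟩, ?_, ?_⟩ <;> simp
  · linarith [Int.floor_le q.1]
  · linarith [Int.lt_floor_add_one q.1]
  · linarith
  · linarith

lemma rel_shift (k : ℤ) (z : Pl) : Rel F z (z + ((k : ℝ), 0)) :=
  ⟨|(k:ℝ)|, fun n => by rw [T.perIter]; simp⟩

variable (hN : ∀ p : Pl, ∀ n : ℕ, 1 ≤ n → aa F n p ≠ 0)
include hN

lemma graph_inv (k : ℤ) (x : ℝ) :
    F (x, (fun x => Y x (x + k)) x) = ((fun x => x + (k:ℝ)) x,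
      (fun x => Y x (x + k)) ((fun x => x + (k:ℝ)) x)) := by
  simp only
  rw [T.psi_inv hN, T.Y_perZ]

lemma disp_ge (k : ℤ) (q : Pl) (h : (k:ℝ) ≤ (F q).1 - q.1) : (k:ℝ) ≤ (F (F q)).1 - (F q).1 := by
  have h3 : Y q.1 (q.1 + k) ≤ q.2 := by
    have : (F (q.1, Y q.1 (q.1 + k))).1 ≤ (F (q.1, q.2)).1 := by
      rw [T.hY]; simp only [Prod.mk.eta]; linarith
    exact (T.mono q.1).le_iff_le.1 this
  have hgm : StrictMono fun x => x + (k:ℝ) := fun a b hab => by simpa using hab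
  have hgs : Surjective fun x => x + (k:ℝ) := fun a => ⟨a - k, by simp⟩
  rcases h3.lt_or_eq with h4 | h4
  · have h5 := (T.above hgm hgs (T.graph_inv hN k) h4).2
    have h6 := (T.above hgm hgs (T.graph_inv hN k) h5).1
    linarith
  · have e : F q = (q.1 + k, Y q.1 (q.1 + k)) := by
      rw [← T.psi_inv hN, h4]
    rw [e]
    have e2 := T.psi_inv hN k (q.1 + k)
    rw [T.Y_perZ] at e2
    rw [e2]; simp

lemma disp_le (k : ℤ) (q : Pl) (h : (F q).1 - q.1 ≤ (k:ℝ)) : (F (F q)).1 - (F q).1 ≤ (k:ℝ) := by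
  have h3 : q.2 ≤ Y q.1 (q.1 + k) := by
    have : (F (q.1, q.2)).1 ≤ (F (q.1, Y q.1 (q.1 + k))).1 := by
      rw [T.hY]; simp only [Prod.mk.eta]; linarith
    exact (T.mono q.1).le_iff_le.1 this
  have hgm : StrictMono fun x => x + (k:ℝ) := fun a b hab => by simpa using hab
  have hgs : Surjective fun x => x + (k:ℝ) := fun a => ⟨a - k, by simp⟩
  rcases h3.lt_or_eq with h4 | h4
  · have h5 := (T.below hgm hgs (T.graph_inv hN k) h4).2
    have h6 := (T.below hgm hgs (T.graph_inv hN k) h5).1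
    linarith
  · have e : F q = (q.1 + k, Y q.1 (q.1 + k)) := by
      rw [← T.psi_inv hN, ← h4]
    rw [e]
    have e2 := T.psi_inv hN k (q.1 + k)
    rw [T.Y_perZ] at e2
    rw [e2]; simp

lemma disp_iter (z : Pl) : ∃ k : ℤ, ∀ n : ℕ, (k:ℝ) ≤ (F (F^[n] z)).1 - (F^[n] z).1 ∧
    (F (F^[n] z)).1 - (F^[n] z).1 ≤ (k:ℝ) + 1 := by
  refine ⟨⌊(F z).1 - z.1⌋, fun n => ?_⟩
  induction n with
  | zero => exact ⟨Int.floor_le _, (Int.lt_floor_add_one _).le⟩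
  | succ n ih =>
    rw [iterate_succ_apply']
    refine ⟨T.disp_ge hN _ _ ih.1, ?_⟩
    have := T.disp_le hN (⌊(F z).1 - z.1⌋ + 1) (F^[n] z) (by push_cast; exact ih.2)
    push_cast at this
    exact this

lemma rel_F (z : Pl) : Rel F z (F z) := by
  obtain ⟨k, hk⟩ := T.disp_iter hN z
  refine ⟨|(k:ℝ)| + 1, fun n => ?_⟩
  rw [← iterate_succ_apply, iterate_succ_apply', abs_le]
  have h1 := neg_abs_le (k:ℝ)
  have h2 := le_abs_self (k:ℝ)
  constructor <;> linarith [(hk n).1, (hk n).2]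

lemma sum_tendsto (z : Pl) : Tendsto (fun n => aa F (n + 1) z + aa F (n + 2) z) atTop atTop := by
  obtain ⟨k, hk⟩ := T.disp_iter hN z
  obtain ⟨β, hβ, hb⟩ := T.twist_lower k
  have hpos : ∀ n, 0 < aa F (n + 1) z := fun n => T.aa_pos hN (by omega) z
  set s : ℕ → ℝ := fun n => -cc F (n + 1) z / aa F (n + 1) z with hs
  have hdiff : ∀ n, s (n + 1) - s n =
      aa F 1 (F^[n + 1] z) / (aa F (n + 1) z * aa F (n + 2) z) := by
    intro n
    have h1 := T.aa_add 1 (n + 1) z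
    have h2 := T.cc_add 1 (n + 1) z
    have h3 := T.det_iter (n + 1) z
    have p1 := (hpos n).ne'
    have p2 := (hpos (n + 1)).ne'
    simp only [hs]
    rw [div_sub_div _ _ p2 p1, div_eq_div_iff (mul_ne_zero p2 p1) (mul_ne_zero p1 p2)]
    rw [show n + 2 = 1 + (n + 1) by ring, h1, h2]
    linear_combination (cc F 1 (F^[n + 1] z) * aa F (n + 1) z + aa F 1 (F^[n + 1] z) * bb F (n + 1) z) * aa F (n + 1) z * (aa F 1 (F^[n + 1] z)) * h3
  have hlow : ∀ n, β ≤ aa F 1 (F^[n + 1] z) := fun n => hb _ (hk (n + 1)).1 (hk (n + 1)).2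
  have hmono : Monotone s := by
    apply monotone_nat_of_le_succ
    intro n
    have := hdiff n
    have h4 : 0 < aa F 1 (F^[n + 1] z) / (aa F (n + 1) z * aa F (n + 2) z) :=
      div_pos (hβ.trans_le (hlow n)) (mul_pos (hpos n) (hpos (n + 1)))
    linarith
  have hbdd : BddAbove (range s) := by
    refine ⟨bb F 1 (G z) / aa F 1 (G z), ?_⟩
    rintro _ ⟨n, rfl⟩
    have h1 := T.aa_add (n + 1) 1 (G z)
    have h2 := T.aa_pos hN (n := n + 1 + 1) (by omega) (G z)
    simp only [iterate_one, T.FG] at h1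
    rw [h1] at h2
    simp only [hs]
    rw [div_le_div_iff₀ (hpos n) (T.aa_one_pos _)]
    nlinarith
  have hlim := tendsto_atTop_ciSup hmono hbdd
  have h0 : Tendsto (fun n => s (n + 1) - s n) atTop (𝓝 0) := by
    have := (hlim.comp (tendsto_add_atTop_nat 1)).sub hlim
    simpa using this
  rw [tendsto_atTop]
  intro M
  have hM : 0 < β / (M ^ 2 + 1) := by positivity
  filter_upwards [h0.eventually (gt_mem_nhds hM)] with n hn
  rw [hdiff] at hn
  have q1 := hpos n
  have q2 := hpos (n + 1)
  rw [show n + 1 + 1 = n + 2 by ring] at q2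
  rw [div_lt_div_iff₀ (mul_pos q1 q2) (by positivity)] at hn
  have h5 := hlow n
  have h6 : β * (M ^ 2 + 1) < β * (aa F (n + 1) z * aa F (n + 2) z) := by
    have : 0 < M ^ 2 + 1 := by positivity
    nlinarith
  have h7 := lt_of_mul_lt_mul_left h6 hβ.le
  by_contra hcon
  push Not at hcon
  nlinarith

lemma unique_aux (x y1 y2 R : ℝ) (h12 : y1 < y2)
    (hR : ∀ n, |(F^[n] (x, y2)).1 - (F^[n] (x, y1)).1| ≤ R) : False := by
  set φ : ℕ → ℝ → ENNReal := fun n y =>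
    ENNReal.ofReal (aa F (n + 1) (x, y) + aa F (n + 2) (x, y)) with hφ
  have hc : ∀ n, Continuous fun y => aa F n (x, y) := fun n =>
    (T.cont_aa n).comp (continuous_const.prodMk continuous_id)
  have hmeas : ∀ n, Measurable (φ n) := fun n =>
    ENNReal.measurable_ofReal.comp ((hc _).add (hc _)).measurable
  have hval : ∀ n, ∫⁻ y in Ioc y1 y2, φ n y ≤ ENNReal.ofReal (2 * R) := by
    intro n
    have hi : IntervalIntegrable (fun y => aa F (n + 1) (x, y) + aa F (n + 2) (x, y)) volume y1 y2 :=
      ((hc _).add (hc _)).intervalIntegrable _ _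
    have h1 := intervalIntegral.integral_eq_sub_of_hasDerivAt (a := y1) (b := y2)
      (fun y _ => (T.hasDerivAt_iter1 (n + 1) x y).add (T.hasDerivAt_iter1 (n + 2) x y)) hi
    rw [intervalIntegral.integral_of_le h12.le] at h1
    rw [← ofReal_integral_eq_lintegral_ofReal
      ((intervalIntegrable_iff_integrableOn_Ioc_of_le h12.le).1 hi)
      (Eventually.of_forall fun y => (add_pos (T.aa_pos hN (by omega) (x, y))
        (T.aa_pos hN (by omega) (x, y))).le)]
    apply ENNReal.ofReal_le_ofReal
    rw [h1]
    simp only [Pi.add_apply]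
    have h2 := le_of_abs_le (hR (n + 1))
    have h3 := le_of_abs_le (hR (n + 2))
    linarith
  have hF := lintegral_liminf_le (u := atTop) (μ := volume.restrict (Ioc y1 y2)) hmeas
  have htop : ∀ y, liminf (fun n => φ n y) atTop = ⊤ := by
    intro y
    exact (ENNReal.tendsto_ofReal_atTop.comp (T.sum_tendsto hN (x, y))).liminf_eq
  simp only [htop] at hF
  rw [lintegral_const] at hF
  simp only [Measure.restrict_apply MeasurableSet.univ, univ_inter, Real.volume_Ioc] at hF
  rw [ENNReal.top_mul (by simpa using h12)] at hF
  have h3 : liminf (fun n => ∫⁻ y in Ioc y1 y2, φ n y) atTop ≤ ENNReal.ofReal (2 * R) := by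
    apply liminf_le_of_le
    · isBoundedDefault
    · intro b hb
      obtain ⟨n, hn⟩ := hb.exists
      exact hn.trans (hval n)
  exact ENNReal.ofReal_ne_top (top_le_iff.1 (hF.trans h3))

lemma rel_unique {x y1 y2 : ℝ} (h : Rel F (x, y1) (x, y2)) : y1 = y2 := by
  rcases lt_trichotomy y1 y2 with h1 | h1 | h1
  · obtain ⟨R, hR⟩ := h.symm
    exact (T.unique_aux hN x y1 y2 R h1 hR).elim
  · exact h1
  · obtain ⟨R, hR⟩ := h
    exact (T.unique_aux hN x y2 y1 R h1 hR).elim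

lemma exists_aux (z : Pl) (x' : ℝ) (h1 : z.1 ≤ x') (h2 : x' ≤ z.1 + 1) :
    ∃ y', ∀ n, (F^[n] z).1 ≤ (F^[n] (x', y')).1 ∧ (F^[n] (x', y')).1 ≤ (F^[n] z).1 + 1 := by
  set I : ℕ → Set ℝ := fun N => {y' | ∀ n ≤ N + 1,
    (F^[n] z).1 ≤ (F^[n] (x', y')).1 ∧ (F^[n] (x', y')).1 ≤ (F^[n] z).1 + 1} with hI
  have hclosed : ∀ N, IsClosed (I N) := by
    intro N
    simp only [hI, ofPred_forall]
    refine isClosed_iInter fun n => isClosed_iInter fun _ => ?_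
    exact (isClosed_le continuous_const (T.cont1 n x')).inter
      (isClosed_le (T.cont1 n x') continuous_const)
  have hgm : ∀ N (u v : Pl) (_ : u.1 = v.1) (_ : (G^[N + 1] v).1 ≤ (G^[N + 1] u).1) (m : ℕ),
      (G^[m] v).1 ≤ (G^[m] u).1 := by
    rintro N ⟨u1, u2⟩ ⟨v1, v2⟩ e h m
    simp only at e
    subst e
    have h3 : u2 ≤ v2 := (T.anti_Giter hN (n := N + 1) (by omega) u1).le_iff_ge.1 h
    rcases Nat.eq_zero_or_pos m with rfl | hm
    · simp
    · exact (T.anti_Giter hN hm u1).antitone h3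
  have hback : ∀ N n, n ≤ N + 1 → ∀ p, G^[N + 1 - n] (F^[N + 1] p) = F^[n] p := by
    intro N n hn p
    have : N + 1 = (N + 1 - n) + n := by omega
    conv_lhs => rw [show F^[N + 1] p = F^[N + 1 - n] (F^[n] p) by
      rw [← iterate_add_apply, ← this]]
    exact T.GF_iter _ _
  have hne : ∀ N, (I N).Nonempty := by
    intro N
    obtain ⟨y', hy'⟩ := T.surj_iter (n := N + 1) (by omega) x' (F^[N + 1] z).1
    obtain ⟨y'', hy''⟩ := T.surj_iter (n := N + 1) (by omega) x' ((F^[N + 1] z).1 + 1)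
    simp only at hy' hy''
    have hyy : y' ≤ y'' := by
      apply (T.mono_iter hN (n := N + 1) (by omega) x').le_iff_le.1
      simp only [hy', hy'']; linarith
    refine ⟨y', fun n hn => ⟨?_, ?_⟩⟩
    · have := hgm N (F^[N + 1] (x', y')) (F^[N + 1] z) hy'
        (by rw [T.GF_iter, T.GF_iter]; exact h1) (N + 1 - n)
      rwa [hback N n hn, hback N n hn] at this
    · have hs : ∀ m, F^[m] (z + (1, 0)) = F^[m] z + (1, 0) := by
        intro m
        have := T.perIter 1 m z
        simpa using this
      have := hgm N (F^[N + 1] (z + (1, 0))) (F^[N + 1] (x', y'')) (by rw [hs, hy'']; simp)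
        (by rw [T.GF_iter, T.GF_iter]; simpa using h2) (N + 1 - n)
      rw [hback N n hn, hback N n hn, hs] at this
      simp only [Prod.fst_add] at this
      refine le_trans ?_ this
      rcases Nat.eq_zero_or_pos n with rfl | hm
      · simp
      · exact (T.mono_iter hN hm x').monotone hyy
  have hcpt : IsCompact (I 0) := by
    refine (isCompact_Icc (a := Y x' (F z).1) (b := Y x' ((F z).1 + 1))).of_isClosed_subset
      (hclosed 0) ?_
    intro y' hy'
    obtain ⟨h3, h4⟩ := hy' 1 (by simp)
    simp only [iterate_one] at h3 h4
    constructor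
    · apply (T.mono x').le_iff_le.1
      simpa only [T.hY] using h3
    · apply (T.mono x').le_iff_le.1
      simpa only [T.hY] using h4
  obtain ⟨y', hy'⟩ := IsCompact.nonempty_iInter_of_sequence_nonempty_isCompact_isClosed I
    (fun N y hy n hn => hy n (by omega)) hne hcpt hclosed
  refine ⟨y', fun n => ?_⟩
  exact mem_iInter.1 hy' n n (by omega)

lemma exists_rel (z : Pl) (x' : ℝ) :
    ∃ y', ∀ n, |(F^[n] z).1 - (F^[n] (x', y')).1| ≤ |x' - z.1| + 2 := by
  set k : ℤ := ⌊x' - z.1⌋ with hk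
  have hk1 := Int.floor_le (x' - z.1)
  have hk2 := Int.lt_floor_add_one (x' - z.1)
  rw [← hk] at hk1 hk2
  obtain ⟨y', hy'⟩ := T.exists_aux hN z (x' - k) (by linarith) (by linarith)
  refine ⟨y', fun n => ?_⟩
  have e : ((x', y') : Pl) = (x' - k, y') + ((k:ℝ), 0) := by simp
  rw [e, T.perIter]
  obtain ⟨h1, h2⟩ := hy' n
  have h3 := le_abs_self (x' - z.1)
  have h4 := neg_abs_le (x' - z.1)
  simp only [Prod.fst_add]
  rw [abs_le]
  constructor <;> linarith

/-- the invariant foliation -/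
lemma foliation : ∃ ψ : ℝ → ℝ → ℝ, (∀ c, Continuous (ψ c)) ∧ (∀ c x, ψ c (x + 1) = ψ c x) ∧
    (∀ x y, ∃ c, ψ c x = y) ∧ (∀ c c' x, ψ c x = ψ c' x → c = c') ∧
    (∀ c x, (F (x, ψ c x)).2 = ψ c (F (x, ψ c x)).1) := by
  choose ψ hψ using fun c : ℝ => T.exists_rel hN (0, c)
  have hrel : ∀ c x, Rel F (0, c) (x, ψ c x) := fun c x => ⟨_, hψ c x⟩
  have huniq : ∀ c x y, Rel F (0, c) (x, y) → y = ψ c x := fun c x y h =>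
    T.rel_unique hN (h.symm.trans (hrel c x))
  refine ⟨ψ, ?_, ?_, ?_, ?_, ?_⟩
  · intro c
    rw [continuous_iff_continuousAt]
    intro x0
    have hev : ∀ᶠ x in 𝓝 x0, |x| + 2 ≤ |x0| + 3 := by
      have : Continuous fun x : ℝ => |x| + 2 := by fun_prop
      have h := this.continuousAt.eventually (gt_mem_nhds (show |x0| + 2 < |x0| + 3 by linarith))
      exact h.mono fun x hx => hx.le
    have hX : ∀ n y, Continuous fun x => (F^[n] (x, y)).1 := fun n y =>
      ((T.cFn n).continuous.comp (continuous_id.prodMk continuous_const)).fst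
    have b0 : ∀ n, |(F^[n] (0, c)).1 - (F^[n] (x0, ψ c x0)).1| ≤ |x0| + 3 := by
      intro n
      have := hψ c x0 n
      simp only [sub_zero] at this
      linarith
    apply tendsto_order.2 ⟨fun a ha => ?_, fun a ha => ?_⟩
    · have : ¬ ∀ n, |(F^[n] (0, c)).1 - (F^[n] (x0, a)).1| ≤ |x0| + 3 := fun h =>
        ha.ne (huniq c x0 a ⟨_, h⟩)
      push Not at this
      obtain ⟨n, hn⟩ := this
      have hn1 : 1 ≤ n := by
        by_contra h0
        have : n = 0 := by omega
        subst this
        simp at hn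
        linarith
      have hm := T.mono_iter hN hn1
      have h1 := hm x0 ha
      simp only at h1
      have h2 := (abs_le.1 (b0 n)).1
      have h3 : (F^[n] (x0, a)).1 < (F^[n] (0, c)).1 - (|x0| + 3) := by
        rcases lt_abs.1 hn with h | h <;> linarith
      filter_upwards [hev, (hX n a).continuousAt.eventually (gt_mem_nhds h3)] with x hx1 hx2
      have h4 := hψ c x n
      simp only [sub_zero] at h4
      have h5 := (abs_le.1 h4).2
      apply (hm x).lt_iff_lt.1
      linarith
    · have : ¬ ∀ n, |(F^[n] (0, c)).1 - (F^[n] (x0, a)).1| ≤ |x0| + 3 := fun h =>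
        ha.ne' (huniq c x0 a ⟨_, h⟩)
      push Not at this
      obtain ⟨n, hn⟩ := this
      have hn1 : 1 ≤ n := by
        by_contra h0
        have : n = 0 := by omega
        subst this
        simp at hn
        linarith
      have hm := T.mono_iter hN hn1
      have h1 := hm x0 ha
      simp only at h1
      have h2 := (abs_le.1 (b0 n)).2
      have h3 : (F^[n] (0, c)).1 + (|x0| + 3) < (F^[n] (x0, a)).1 := by
        rcases lt_abs.1 hn with h | h <;> linarith
      filter_upwards [hev, (hX n a).continuousAt.eventually (lt_mem_nhds h3)] with x hx1 hx2
      have h4 := hψ c x n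
      simp only [sub_zero] at h4
      have h5 := (abs_le.1 h4).1
      apply (hm x).lt_iff_lt.1
      linarith
  · intro c x
    symm
    apply huniq
    have := T.rel_shift 1 (x, ψ c x)
    simp only [Int.cast_one, Prod.mk_add_mk, add_zero] at this
    exact (hrel c x).trans this
  · intro x y
    obtain ⟨c, hc⟩ := T.exists_rel hN (x, y) 0
    exact ⟨c, (huniq c x y (Rel.symm ⟨_, hc⟩)).symm⟩
  · intro c c' x h
    have h1 := hrel c' x
    rw [← h] at h1
    exact T.rel_unique hN ((hrel c x).trans h1.symm)
  · intro c x
    apply huniq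
    exact (hrel c x).trans (T.rel_F hN _)

end TM
end CS

namespace CS

abbrev Ci : Type := AddCircle (1:ℝ)

lemma cont_pr : Continuous pr :=
  ((AddCircle.continuous_mk' (1:ℝ)).comp continuous_fst).prodMk continuous_snd

lemma coe_eq_iff {a b : ℝ} : ((a : Ci) = (b : Ci)) ↔ ∃ k : ℤ, a = b + k := by
  rw [← sub_eq_zero, ← AddCircle.coe_sub, AddCircle.coe_eq_zero_iff]
  constructor
  · rintro ⟨n, hn⟩
    refine ⟨n, ?_⟩
    simp at hn
    linarith
  · rintro ⟨n, hn⟩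
    refine ⟨n, ?_⟩
    simp
    linarith

lemma pr_eq_iff {p q : Pl} : pr p = pr q ↔ ∃ k : ℤ, p = q + ((k:ℝ), 0) := by
  unfold pr
  rw [Prod.ext_iff]
  simp only [coe_eq_iff]
  constructor
  · rintro ⟨⟨k, hk⟩, h⟩
    exact ⟨k, Prod.ext hk (by simpa using h)⟩
  · rintro ⟨k, rfl⟩
    exact ⟨⟨k, rfl⟩, by simp⟩

lemma pr_surj : Surjective pr := by
  rintro ⟨θ, y⟩
  obtain ⟨x, rfl⟩ := QuotientAddGroup.mk_surjective θ
  exact ⟨(x, y), rfl⟩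

lemma pr_open : IsOpenQuotientMap pr :=
  IsOpenQuotientMap.prodMap (QuotientAddGroup.isOpenQuotientMap_mk) IsOpenQuotientMap.id

lemma intval_const {φ : ℝ → ℝ} (hc : Continuous φ) (hi : ∀ x, ∃ k : ℤ, φ x = k) (x y : ℝ) :
    φ x = φ y := by
  have key : ∀ x y, ¬ φ x < φ y := by
    intro x y h
    obtain ⟨k, hk⟩ := hi x
    obtain ⟨m, hm⟩ := hi y
    have h1 : k + 1 ≤ m := by
      rw [hk, hm] at h
      exact_mod_cast h
    have h2 : ((k:ℝ) + 1) ≤ m := by exact_mod_cast h1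
    have : φ x + 1 / 2 ∈ range φ := by
      apply mem_range_of_exists_le_of_exists_ge hc ⟨x, by linarith⟩ ⟨y, by linarith⟩
    obtain ⟨u, hu⟩ := this
    obtain ⟨j, hj⟩ := hi u
    rw [hj, hk] at hu
    have h3 : 2 * j = 2 * k + 1 := by
      have : (2:ℝ) * j = 2 * k + 1 := by linarith
      exact_mod_cast this
    omega
  exact le_antisymm (not_lt.1 (key y x)) (not_lt.1 (key x y))

/-- lifting maps to the circle -/
lemma exists_lift {A : Type*} [TopologicalSpace A] [SimplyConnectedSpace A]
    [LocallyPathConnectedSpace A] [Nonempty A] (f : A → Ci) (hf : Continuous f) :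
    ∃ g : A → ℝ, Continuous g ∧ ∀ a, ((g a : ℝ) : Ci) = f a := by
  obtain ⟨a0⟩ := ‹Nonempty A›
  obtain ⟨e0, he0⟩ := QuotientAddGroup.mk_surjective (f a0)
  obtain ⟨g, ⟨-, hg⟩, -⟩ := (AddCircle.isCoveringMap_coe (1:ℝ)).existsUnique_continuousMap_lifts
    ⟨f, hf⟩ a0 e0 he0
  exact ⟨g, g.continuous, fun a => congrFun hg a⟩

lemma not_null (γ : C(Ci, Ann)) (hγ : ∀ θ, (γ θ).1 = θ) (z : Ann) :
    ¬ γ.Homotopic (ContinuousMap.const _ z) := by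
  rintro ⟨H⟩
  obtain ⟨g, hg, hgl⟩ := exists_lift
    (fun q : ℝ × ℝ => (H (projIcc 0 1 zero_le_one q.1, (q.2 : Ci))).1) (by
      have h1 : Continuous fun q : ℝ × ℝ => (q.2 : Ci) :=
        (AddCircle.continuous_mk' (1:ℝ)).comp continuous_snd
      have h2 : Continuous fun q : ℝ × ℝ => projIcc (0:ℝ) 1 zero_le_one q.1 :=
        continuous_projIcc.comp continuous_fst
      exact (H.continuous.comp (h2.prodMk h1)).fst)
  have h0 : ∀ t, g (0, t) - t = g (0, 0) - 0 := by
    intro t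
    refine intval_const (φ := fun t => g (0, t) - t)
      ((hg.comp (continuous_const.prodMk continuous_id)).sub continuous_id) (fun t => ?_) t 0
    have := hgl (0, t)
    simp [hγ] at this
    obtain ⟨k, hk⟩ := coe_eq_iff.1 this
    exact ⟨k, by rw [hk]; ring⟩
  have h1 : ∀ t, g (1, t) - g (1, 0) = g (1, 0) - g (1, 0) := by
    intro t
    refine intval_const (φ := fun t => g (1, t) - g (1, 0))
      ((hg.comp (continuous_const.prodMk continuous_id)).sub continuous_const) (fun t => ?_) t 0
    have e1 := hgl (1, t)
    have e2 := hgl (1, 0)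
    simp at e1 e2
    obtain ⟨k, hk⟩ := coe_eq_iff.1 (e1.trans e2.symm)
    exact ⟨k, by rw [hk]; ring⟩
  have h2 : g (0, 1) - g (0, 0) = g (1, 1) - g (1, 0) := by
    refine intval_const (φ := fun s => g (s, 1) - g (s, 0))
      ((hg.comp (continuous_id.prodMk continuous_const)).sub
        (hg.comp (continuous_id.prodMk continuous_const))) (fun s => ?_) 0 1
    have e1 := hgl (s, 1)
    have e2 := hgl (s, 0)
    have e3 : ((1:ℝ) : Ci) = ((0:ℝ) : Ci) := coe_eq_iff.2 ⟨1, by simp⟩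
    simp only [e3] at e1
    obtain ⟨k, hk⟩ := coe_eq_iff.1 (e1.trans e2.symm)
    exact ⟨k, by rw [hk]; ring⟩
  have h3 := h0 1
  have h4 := h1 1
  linarith

/-- the closed curve which is the graph of a periodic function -/
lemma exists_graph_curve {ψ : ℝ → ℝ} (hc : Continuous ψ) (hp : ∀ x, ψ (x + 1) = ψ x) :
    ∃ γ : C(Ci, Ann), EssentialCurve γ ∧ ∀ x : ℝ, γ (x : Ci) = pr (x, ψ x) := by
  have hper : Periodic ψ 1 := hp
  have hcl : Continuous (hper.lift : Ci → ℝ) := by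
    rw [← (QuotientAddGroup.isOpenQuotientMap_mk
      (N := AddSubgroup.zmultiples (1:ℝ))).continuous_comp_iff]
    exact hc
  refine ⟨⟨fun θ => (θ, hper.lift θ), continuous_id.prodMk hcl⟩, ⟨?_, ?_⟩, fun x => rfl⟩
  · apply Topology.IsClosedEmbedding.isEmbedding
    apply Continuous.isClosedEmbedding
    · exact ContinuousMap.continuous _
    · intro a b hab
      exact congrArg Prod.fst hab
  · intro z
    apply not_null
    intro θ
    rfl

/-- assembly of an invariant foliation by graphs -/
lemma integrable_of_foliation {f : Ann → Ann} {F G : Pl → Pl} (hlift : ∀ p, pr (F p) = f (pr p))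
    (hFG : ∀ p, F (G p) = p)
    (h : ∃ ψ : ℝ → ℝ → ℝ, (∀ c, Continuous (ψ c)) ∧ (∀ c x, ψ c (x + 1) = ψ c x) ∧
    (∀ x y, ∃ c, ψ c x = y) ∧ (∀ c c' x, ψ c x = ψ c' x → c = c') ∧
    (∀ c x, (F (x, ψ c x)).2 = ψ c (F (x, ψ c x)).1)) : C0IntegrableOn f univ := by
  obtain ⟨ψ, h1, h2, h3, h4, h5⟩ := h
  choose γ hγ hγ' using fun c => exists_graph_curve (h1 c) (h2 c)
  have hr : ∀ c z, z ∈ range (γ c) ↔ ∃ x, z = pr (x, ψ c x) := by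
    intro c z
    constructor
    · rintro ⟨θ, rfl⟩
      obtain ⟨x, rfl⟩ := QuotientAddGroup.mk_surjective θ
      exact ⟨x, hγ' c x⟩
    · rintro ⟨x, rfl⟩
      exact ⟨x, hγ' c x⟩
  refine ⟨ℝ, γ, fun c => ⟨hγ c, ?_⟩, ?_, ?_⟩
  · ext z
    constructor
    · rintro ⟨w, hw, rfl⟩
      obtain ⟨x, rfl⟩ := (hr c w).1 hw
      rw [hr, ← hlift]
      exact ⟨(F (x, ψ c x)).1, by rw [← h5]⟩
    · intro hz
      obtain ⟨x, rfl⟩ := (hr c z).1 hz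
      obtain ⟨c', hc'⟩ := h3 (G (x, ψ c x)).1 (G (x, ψ c x)).2
      have h6 := h5 c' (G (x, ψ c x)).1
      rw [hc'] at h6
      simp only [Prod.mk.eta, hFG] at h6
      have h7 := h4 _ _ _ h6
      subst h7
      refine ⟨pr (G (x, ψ c x)), ?_, ?_⟩
      · rw [hr]
        exact ⟨(G (x, ψ c x)).1, by rw [hc']⟩
      · rw [← hlift, hFG]
  · rw [eq_univ_iff_forall]
    intro z
    obtain ⟨⟨x, y⟩, rfl⟩ := pr_surj z
    obtain ⟨c, hc⟩ := h3 x y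
    rw [mem_iUnion]
    exact ⟨c, (hr c _).2 ⟨x, by rw [hc]⟩⟩
  · intro c c' hne
    rw [onFun, Set.disjoint_left]
    intro z hz hz'
    obtain ⟨x, rfl⟩ := (hr c z).1 hz
    obtain ⟨x', hx'⟩ := (hr c' _).1 hz'
    obtain ⟨k, hk⟩ := pr_eq_iff.1 hx'
    have hper : Periodic (ψ c') 1 := h2 c'
    have e1 := congrArg Prod.fst hk
    have e2 := congrArg Prod.snd hk
    simp at e1 e2
    apply hne
    apply h4 c c' x
    rw [e2, e1]
    have := hper.int_mul k x'
    simpa using this.symm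

/-- lift of an essential curve -/
lemma lift_essential {γ : C(Ci, Ann)} (hγ : EssentialCurve γ) :
    ∃ (g : ℝ → Pl) (d : ℤ), Continuous g ∧ (∀ t : ℝ, pr (g t) = γ (t : Ci)) ∧ d ≠ 0 ∧
      ∀ t, g (t + 1) = g t + ((d:ℝ), 0) := by
  have hcc : Continuous fun t : ℝ => γ (t : Ci) :=
    γ.continuous.comp (AddCircle.continuous_mk' (1:ℝ))
  obtain ⟨u, hu, hul⟩ := exists_lift (fun t : ℝ => (γ (t : Ci)).1) hcc.fst
  have e3 : ∀ t : ℝ, ((t + 1 : ℝ) : Ci) = (t : Ci) := fun t => AddCircle.coe_add_period 1 t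
  have hval : ∀ t, ∃ k : ℤ, u (t + 1) - u t = k := by
    intro t
    have h1 := hul (t + 1)
    rw [e3] at h1
    obtain ⟨k, hk⟩ := coe_eq_iff.1 (h1.trans (hul t).symm)
    exact ⟨k, by rw [hk]; ring⟩
  obtain ⟨d, hd⟩ := hval 0
  have hconst : ∀ t, u (t + 1) - u t = d := by
    intro t
    rw [← hd]
    exact intval_const (φ := fun t => u (t + 1) - u t)
      ((hu.comp (continuous_id.add continuous_const)).sub hu) hval t 0
  refine ⟨fun t => (u t, (γ (t : Ci)).2), d, hu.prodMk hcc.snd, ?_, ?_, ?_⟩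
  · intro t
    unfold pr
    exact Prod.ext (hul t) rfl
  · rintro rfl
    have hper : Periodic u 1 := fun t => by have := hconst t; simp at this; linarith
    have hcl : Continuous (hper.lift : Ci → ℝ) := by
      rw [← (QuotientAddGroup.isOpenQuotientMap_mk
        (N := AddSubgroup.zmultiples (1:ℝ))).continuous_comp_iff]
      exact hu
    let γ' : C(Ci, Pl) := ⟨fun θ => (hper.lift θ, (γ θ).2), hcl.prodMk γ.continuous.snd⟩
    let π : C(Pl, Ann) := ⟨pr, cont_pr⟩
    have e : γ = π.comp γ' := by
      ext1 θ
      obtain ⟨t, rfl⟩ := QuotientAddGroup.mk_surjective θ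
      exact Prod.ext (hul t).symm rfl
    apply hγ.2 (pr 0)
    have h1 : γ'.Homotopic (ContinuousMap.const _ 0) := ⟨ContinuousMap.Homotopy.affine _ _⟩
    have h2 := (ContinuousMap.Homotopic.refl π).comp h1
    rw [e]
    exact h2
  · intro t
    have := hconst t
    refine Prod.ext ?_ ?_
    · simp; linarith
    · simp [e3]

end CS

namespace CS

/-- lift of an invariant essential curve, as a subset of the plane -/
structure Leaf (F : Pl → Pl) (K : Set Pl) : Prop where
  closed : IsClosed K
  per : ∀ (k : ℤ) p, p + ((k:ℝ), 0) ∈ K ↔ p ∈ K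
  inv : ∀ p, F p ∈ K ↔ p ∈ K
  bdd : ∃ B : ℝ, ∀ p ∈ K, |p.2| ≤ B
  ne : K.Nonempty
  path : ∀ w ∈ K, ∃ c : ℝ → Pl, Continuous c ∧ (∀ s, c s ∈ K) ∧ c 0 = w ∧
    ∀ M : ℝ, ∃ s, ∃ m : ℤ, M ≤ m ∧ c s = w + (((-m : ℤ) : ℝ), 0)

/-- recurrence in the plane -/
def Rec (F : Pl → Pl) : Prop := ∀ O : Set Pl, IsOpen O → O.Nonempty →
  ∃ p ∈ O, ∃ q ∈ O, ∃ m : ℕ, 1 ≤ m ∧ ∃ k : ℤ, F^[m] p = q + ((k:ℝ), 0)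

/-- the points above the leaf -/
def Ab (K : Set Pl) : Set Pl := {p | ∀ w ∈ K, w.1 = p.1 → w.2 < p.2}

namespace Leaf
variable {F : Pl → Pl} {K : Set Pl} (L : Leaf F K)
include L

lemma isOpen_Ab : IsOpen (Ab K) := by
  obtain ⟨B, hB⟩ := L.bdd
  have e : (Ab K)ᶜ = Prod.fst '' {q : Pl × (Icc (-B) B) | (q.1.1, (q.2 : ℝ)) ∈ K ∧
      q.1.2 ≤ (q.2:ℝ)} := by
    ext p
    constructor
    · intro h
      simp only [Ab, mem_compl_iff, mem_ofPred_eq, not_forall, not_lt] at h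
      obtain ⟨w, hw, h1, h2⟩ := h
      refine ⟨(p, ⟨w.2, abs_le.1 (hB _ hw)⟩), ⟨?_, h2⟩, rfl⟩
      rw [← h1]
      exact hw
    · rintro ⟨⟨q, t⟩, ⟨h1, h2⟩, rfl⟩
      intro h
      exact absurd (h (q.1, t) h1 rfl) (not_lt.2 h2)
  rw [← isClosed_compl_iff, e]
  apply isClosedMap_fst_of_compactSpace
  have c1 : Continuous fun q : Pl × (Icc (-B) B) => ((q.1.1, (q.2 : ℝ)) : Pl) := by fun_prop
  exact (L.closed.preimage c1).inter (isClosed_le (f := fun q : Pl × Icc (-B) B => q.1.2)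
    (g := fun q => (q.2:ℝ)) (by fun_prop) (by fun_prop))

lemma Ab_per (k : ℤ) (p : Pl) (hp : p ∈ Ab K) : p + ((k:ℝ), 0) ∈ Ab K := by
  intro w hw h
  have h1 : w + (((-k : ℤ) : ℝ), 0) ∈ K := (L.per _ _).2 hw
  have := hp _ h1 (by simp [h])
  simpa using this

lemma inv_iter (n : ℕ) (p : Pl) : F^[n] p ∈ K ↔ p ∈ K := by
  induction n with
  | zero => rfl
  | succ n ih => rw [iterate_succ_apply', L.inv, ih]

omit L in
lemma Ab_not {p : Pl} (hp : p ∈ Ab K) : p ∉ K := fun h => lt_irrefl _ (hp p h rfl)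

end Leaf

namespace TM
variable {F G : Pl → Pl} {Y : ℝ → ℝ → ℝ} {Sg : Pl → ℝ} (T : TM F G Y Sg)
include T

lemma resolve {K : Set Pl} (L : Leaf F K) {z w : Pl} {n : ℕ} (hz : z ∈ Ab K)
    (hzn : F^[n] z ∈ Ab K) (hw : w ∈ K) {i j : ℕ} (hij : i < j) (hj : j ≤ n)
    (h1 : (F^[i] w).1 ≤ (F^[i] z).1) (h2 : (F^[j] z).1 ≤ (F^[j] w).1) :
    ∃ i j : ℕ, i < j ∧ j ≤ n ∧ (F^[i] w).1 < (F^[i] z).1 ∧ (F^[j] z).1 < (F^[j] w).1 := by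
  have hne : ∀ m, (F^[m] w).1 = (F^[m] z).1 → (F^[m] w).2 ≠ (F^[m] z).2 := by
    intro m e1 e2
    have : F^[m] w = F^[m] z := Prod.ext e1 e2
    have h3 : F^[m] w ∈ K := (L.inv_iter m w).2 hw
    rw [this, L.inv_iter] at h3
    exact Leaf.Ab_not hz h3
  have hs : ∀ m p, F^[m + 1] p = F (F^[m] p) := fun m p => iterate_succ_apply' _ _ _
  have hi : ∃ i', i' < j ∧ (F^[i'] w).1 < (F^[i'] z).1 := by
    rcases h1.lt_or_eq with h | h
    · exact ⟨i, hij, h⟩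
    · rcases lt_or_gt_of_ne (hne i h) with h3 | h3
      · have h4 := T.fwd h h3
        rw [← hs, ← hs] at h4
        refine ⟨i + 1, ?_, h4⟩
        rcases Nat.lt_or_ge (i + 1) j with h5 | h5
        · exact h5
        · have : j = i + 1 := by omega
          subst this
          linarith
      · rcases Nat.eq_zero_or_pos i with rfl | hpos
        · exact absurd (hz w hw h) (by simpa using h3.le)
        · obtain ⟨m, rfl⟩ : ∃ m, i = m + 1 := ⟨i - 1, by omega⟩
          rw [hs, hs] at h h3
          exact ⟨m, by omega, T.bwd h.symm h3⟩
  obtain ⟨i', hi', hlt⟩ := hi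
  rcases h2.lt_or_eq with h | h
  · exact ⟨i', j, hi', hj, hlt, h⟩
  · rcases lt_or_gt_of_ne (hne j h.symm) with h3 | h3
    · obtain ⟨m, rfl⟩ : ∃ m, j = m + 1 := ⟨j - 1, by omega⟩
      rw [hs, hs] at h h3
      have h4 := T.bwd h.symm h3
      refine ⟨i', m, ?_, by omega, hlt, h4⟩
      rcases Nat.lt_or_ge i' m with h5 | h5
      · exact h5
      · have : i' = m := by omega
        subst this
        linarith
    · have h4 := T.fwd h h3
      rw [← hs, ← hs] at h4
      refine ⟨i', j + 1, by omega, ?_, hlt, h4⟩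
      by_contra hcon
      have : j = n := by omega
      subst this
      have := hzn (F^[j] w) ((L.inv_iter j w).2 hw) h.symm
      linarith

lemma no_cross {K : Set Pl} (L : Leaf F K) {z w : Pl} {n : ℕ} (hz : z ∈ Ab K)
    (hzn : F^[n] z ∈ Ab K) (hw : w ∈ K) {i j : ℕ} (hij : i < j) (hj : j ≤ n)
    (h1 : (F^[i] w).1 < (F^[i] z).1) (h2 : (F^[j] z).1 < (F^[j] w).1) : False := by
  obtain ⟨c, hc, hcK, hc0, hcm⟩ := L.path w hw
  have hcF : ∀ m, Continuous fun s => (F^[m] (c s)).1 := fun m =>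
    ((T.cFn m).continuous.comp hc).fst
  set B : Set ℝ := {s | ∃ i j : ℕ, i < j ∧ j ≤ n ∧ (F^[i] (c s)).1 < (F^[i] z).1 ∧
    (F^[j] z).1 < (F^[j] (c s)).1} with hB
  have hBo : IsOpen B := by
    have : B = ⋃ (i : ℕ) (j : ℕ) (_ : i < j) (_ : j ≤ n), ({s | (F^[i] (c s)).1 < (F^[i] z).1} ∩
        {s | (F^[j] z).1 < (F^[j] (c s)).1}) := by
      ext s
      simp only [hB, mem_ofPred_eq, mem_iUnion, mem_inter_iff, exists_prop]
    rw [this]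
    exact isOpen_iUnion fun i => isOpen_iUnion fun j => isOpen_iUnion fun _ =>
      isOpen_iUnion fun _ => (isOpen_lt (hcF i) continuous_const).inter
        (isOpen_lt continuous_const (hcF j))
  have hBc : IsClosed B := by
    have : B = ⋃ q ∈ {q : Fin (n + 1) × Fin (n + 1) | q.1 < q.2},
        ({s | (F^[q.1] (c s)).1 ≤ (F^[q.1] z).1} ∩
        {s | (F^[q.2] z).1 ≤ (F^[q.2] (c s)).1}) := by
      ext s
      simp only [hB, mem_ofPred_eq, mem_iUnion, mem_inter_iff, Prod.exists, exists_prop]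
      constructor
      · rintro ⟨i, j, a, b, c1, c2⟩
        exact ⟨⟨i, by omega⟩, ⟨j, by omega⟩, a, c1.le, c2.le⟩
      · rintro ⟨i, j, a, c1, c2⟩
        exact T.resolve L hz hzn (hcK s) (i := i) (j := j) a (by omega) c1 c2
    rw [this]
    exact (Set.toFinite _).isClosed_biUnion fun q _ =>
      (isClosed_le (hcF q.1) continuous_const).inter (isClosed_le continuous_const (hcF q.2))
  have h0 : (0:ℝ) ∈ B := ⟨i, j, hij, hj, by rwa [hc0], by rwa [hc0]⟩
  have huniv : B = univ := IsClopen.eq_univ ⟨hBc, hBo⟩ ⟨0, h0⟩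
  have hM : ∃ M : ℝ, ∀ m ≤ n, (F^[m] w).1 - (F^[m] z).1 ≤ M := by
    obtain ⟨M, hM⟩ := ((Finset.range (n + 1)).image
      fun m => (F^[m] w).1 - (F^[m] z).1).bddAbove
    exact ⟨M, fun m hm => hM (by simp; exact ⟨m, by omega, rfl⟩)⟩
  obtain ⟨M, hM⟩ := hM
  obtain ⟨s, m, hm, hcs⟩ := hcm M
  have hs : s ∈ B := by rw [huniv]; trivial
  obtain ⟨i, j, -, hj, -, h4⟩ := hs
  rw [hcs, T.perIter] at h4
  simp at h4
  have := hM j hj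
  linarith

lemma P1 {K : Set Pl} (L : Leaf F K) (hrec : Rec F) {z w : Pl} (hz : z ∈ Ab K) (hw : w ∈ K)
    (h1 : w.1 < z.1) (h2 : (F z).1 < (F w).1) : False := by
  obtain ⟨p, hp, q, hq, m, hm, k, hk⟩ := hrec
    (Ab K ∩ ({p | w.1 < p.1} ∩ {p | (F p).1 < (F w).1}))
    (L.isOpen_Ab.inter ((isOpen_lt continuous_const continuous_fst).inter
      (isOpen_lt T.contF.fst continuous_const))) ⟨z, hz, h1, h2⟩
  refine T.no_cross L (n := m) (i := 0) (j := 1) hp.1 ?_ hw one_pos hm hp.2.1 hp.2.2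
  rw [hk]
  exact L.Ab_per k q hq.1

lemma P2 {K : Set Pl} (L : Leaf F K) (hrec : Rec F) {z w : Pl} (hz : z ∈ Ab K) (hw : w ∈ K)
    (h1 : (G w).1 < (G z).1) (h2 : z.1 < w.1) : False := by
  obtain ⟨p, hp, q, hq, m, hm, k, hk⟩ := hrec
    (Ab K ∩ ({p | (G w).1 < (G p).1} ∩ {p | p.1 < w.1}))
    (L.isOpen_Ab.inter ((isOpen_lt continuous_const T.contG.fst).inter
      (isOpen_lt continuous_fst continuous_const))) ⟨z, hz, h1, h2⟩
  have hp' := L.Ab_per (-k) p hp.1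
  have hq' : F^[m] (p + (((-k : ℤ) : ℝ), 0)) = q := by
    rw [T.perIter, hk]
    ext <;> simp
  have hw' : G^[m] w ∈ K := by rw [← L.inv_iter m, T.FG_iter]; exact hw
  have hback : ∀ u, F^[m - 1] u = G (F^[m] u) := by
    intro u
    obtain ⟨l, rfl⟩ : ∃ l, m = l + 1 := ⟨m - 1, by omega⟩
    rw [iterate_succ_apply', T.GF, Nat.add_sub_cancel]
  refine T.no_cross L (n := m) (i := m - 1) (j := m) hp' ?_ hw' (by omega) le_rfl ?_ ?_
  · rw [hq']; exact hq.1
  · rw [hback, hback, T.FG_iter, hq']; exact hq.2.1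
  · rw [T.FG_iter, hq']; exact hq.2.2

omit T in
lemma fiber_ne {K : Set Pl} (L : Leaf F K) (x : ℝ) : ∃ y, (x, y) ∈ K := by
  obtain ⟨w, hw⟩ := L.ne
  obtain ⟨k, hk⟩ := exists_int_gt (x - w.1)
  have hw' := (L.per k w).2 hw
  obtain ⟨c, hc, hcK, hc0, hcm⟩ := L.path _ hw'
  obtain ⟨s, m, hm, hcs⟩ := hcm (w.1 + k - x)
  have : x ∈ range fun s => (c s).1 := by
    apply mem_range_of_exists_le_of_exists_ge hc.fst
    · refine ⟨s, ?_⟩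
      simp only [hcs]; simp; linarith
    · refine ⟨0, ?_⟩
      simp only [hc0]; simp; linarith
  obtain ⟨u, hu⟩ := this
  simp only at hu
  exact ⟨(c u).2, by rw [← hu]; exact hcK u⟩

lemma top_graph {K : Set Pl} (L : Leaf F K) (hrec : Rec F) : ∃ ψ : ℝ → ℝ, Continuous ψ ∧
    (∀ x, ψ (x + 1) = ψ x) ∧ ∀ x, (x, ψ x) ∈ K := by
  have hex : ∀ x, ∃ y, (x, y) ∈ K ∧ ∀ y', (x, y') ∈ K → y' ≤ y := by
    intro x
    obtain ⟨B, hB⟩ := L.bdd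
    have hcpt : IsCompact {y | (x, y) ∈ K} := by
      refine (isCompact_Icc (a := -B) (b := B)).of_isClosed_subset ?_ ?_
      · exact L.closed.preimage (continuous_const.prodMk continuous_id)
      · intro y hy
        exact abs_le.1 (hB _ hy)
    obtain ⟨y, hy, hy'⟩ := hcpt.exists_isGreatest (fiber_ne L x)
    exact ⟨y, hy, fun y' h => hy' h⟩
  choose ψ hψ hmax using hex
  have hAb : ∀ x y, (x, y) ∈ Ab K ↔ ψ x < y := by
    intro x y
    constructor
    · intro h
      exact h _ (hψ x) rfl
    · rintro h ⟨w1, w2⟩ hw e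
      simp only at e
      subst e
      exact (hmax _ _ hw).trans_lt h
  refine ⟨ψ, ?_, ?_, hψ⟩
  · rw [continuous_iff_continuousAt]
    intro x0
    have cx : ∀ a : ℝ, Continuous fun x : ℝ => ((x, a) : Pl) := fun a => by fun_prop
    apply tendsto_order.2 ⟨fun a ha => ?_, fun a ha => ?_⟩
    · obtain ⟨a', h1, h2⟩ := exists_between ha
      have e1 : (F (x0, a')).1 < (F (x0, ψ x0)).1 := T.mono x0 h2
      have e2 : (G (x0, ψ x0)).1 < (G (x0, a')).1 := T.antiG x0 h2
      filter_upwards [(T.contF.comp (cx a')).fst.continuousAt.eventually (gt_mem_nhds e1),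
        (T.contG.comp (cx a')).fst.continuousAt.eventually (lt_mem_nhds e2)] with x g1 g2
      by_contra hcon
      push Not at hcon
      have hz : (x, a') ∈ Ab K := (hAb _ _).2 (hcon.trans_lt h1)
      rcases lt_trichotomy x0 x with h | h | h
      · exact T.P1 L hrec hz (hψ x0) h g1
      · subst h; linarith
      · exact T.P2 L hrec hz (hψ x0) g2 h
    · have : (x0, a) ∈ Ab K := (hAb _ _).2 ha
      filter_upwards [(cx a).continuousAt.eventually (L.isOpen_Ab.mem_nhds this)] with x hx
      exact (hAb _ _).1 hx
  · intro x
    apply le_antisymm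
    · apply hmax
      have := (L.per (-1) _).2 (hψ (x + 1))
      simpa using this
    · apply hmax
      have := (L.per 1 _).2 (hψ x)
      simpa using this

end TM

lemma circ_surj {e : Ci → Ci} (hc : Continuous e) (hi : Injective e) : Surjective e := by
  obtain ⟨u, hu, hul⟩ := exists_lift (fun t : ℝ => e (t : Ci))
    (hc.comp (AddCircle.continuous_mk' (1:ℝ)))
  have e3 : ∀ t : ℝ, ((t + 1 : ℝ) : Ci) = (t : Ci) := fun t => AddCircle.coe_add_period 1 t
  have hval : ∀ t, ∃ k : ℤ, u (t + 1) - u t = k := by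
    intro t
    have h1 := hul (t + 1)
    rw [e3] at h1
    obtain ⟨k, hk⟩ := coe_eq_iff.1 (h1.trans (hul t).symm)
    exact ⟨k, by rw [hk]; ring⟩
  obtain ⟨d, hd⟩ := hval 0
  have hconst : ∀ t, u (t + 1) - u t = d := by
    intro t
    rw [← hd]
    exact intval_const (φ := fun t => u (t + 1) - u t)
      ((hu.comp (continuous_id.add continuous_const)).sub hu) hval t 0
  have hd0 : d ≠ 0 := by
    rintro rfl
    have hper : ∀ t, u (t + 1) = u t := fun t => by have := hconst t; simp at this; linarith
    set φ : ℝ → ℝ := fun x => u (x + 1 / 2) - u x with hφ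
    have hφc : Continuous φ := (hu.comp (continuous_id.add continuous_const)).sub hu
    have h1 : φ (1 / 2) = - φ 0 := by
      simp only [hφ]
      have := hper 0
      norm_num at this ⊢
      linarith
    have h0 : (0:ℝ) ∈ range φ := by
      rcases le_total (φ 0) 0 with h | h
      · exact mem_range_of_exists_le_of_exists_ge hφc ⟨0, h⟩ ⟨1 / 2, by linarith⟩
      · exact mem_range_of_exists_le_of_exists_ge hφc ⟨1 / 2, by linarith⟩ ⟨0, h⟩
    obtain ⟨x, hx⟩ := h0
    have h2 : u (x + 1 / 2) = u x := by simp only [hφ] at hx; linarith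
    have h3 : e ((x + 1 / 2 : ℝ) : Ci) = e (x : Ci) := by rw [← hul, ← hul, h2]
    obtain ⟨k, hk⟩ := coe_eq_iff.1 (hi h3)
    have h4 : (2:ℝ) * k = 1 := by linarith
    have h5 : 2 * k = 1 := by exact_mod_cast h4
    omega
  have hN : ∀ n : ℕ, u n = u 0 + n * d := by
    intro n
    induction n with
    | zero => simp
    | succ n ih =>
      have := hconst n
      push_cast
      linarith
  have hN' : ∀ n : ℕ, u (-n) = u 0 - n * d := by
    intro n
    induction n with
    | zero => simp
    | succ n ih =>
      have := hconst (-((n + 1 : ℕ) : ℝ))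
      have e4 : -((n + 1 : ℕ) : ℝ) + 1 = -n := by push_cast; ring
      rw [e4] at this
      push_cast at this ⊢
      linarith
  intro θ
  obtain ⟨r, rfl⟩ := QuotientAddGroup.mk_surjective θ
  have hr : r ∈ range u := by
    obtain ⟨n, hn⟩ := exists_nat_gt |r - u 0|
    have hn1 := le_abs_self (r - u 0)
    have hn2 := neg_abs_le (r - u 0)
    have a1 := hN n
    have a2 := hN' n
    have hn0 : (0:ℝ) ≤ n := Nat.cast_nonneg n
    rcases lt_or_gt_of_ne hd0 with h | h
    · have h' : (d:ℝ) ≤ -1 := by exact_mod_cast (by omega : d ≤ -1)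
      exact mem_range_of_exists_le_of_exists_ge hu ⟨n, by nlinarith⟩ ⟨-n, by nlinarith⟩
    · have h' : (1:ℝ) ≤ d := by exact_mod_cast (by omega : 1 ≤ d)
      exact mem_range_of_exists_le_of_exists_ge hu ⟨-n, by nlinarith⟩ ⟨n, by nlinarith⟩
  obtain ⟨t, rfl⟩ := hr
  exact ⟨t, (hul t).symm⟩

lemma graph_fills {γ : C(Ci, Ann)} (hγ : EssentialCurve γ) {ψ : ℝ → ℝ} (hc : Continuous ψ)
    (hp : ∀ x, ψ (x + 1) = ψ x) (hK : ∀ x, pr (x, ψ x) ∈ range γ) (p : Pl)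
    (hpK : pr p ∈ range γ) : p.2 = ψ p.1 := by
  obtain ⟨δ, hδ, hδ'⟩ := exists_graph_curve hc hp
  have : ∀ θ, ∃ τ, γ τ = δ θ := by
    intro θ
    obtain ⟨x, rfl⟩ := QuotientAddGroup.mk_surjective θ
    obtain ⟨τ, hτ⟩ := hK x
    exact ⟨τ, hτ.trans (hδ' x).symm⟩
  choose e he using this
  have hec : Continuous e := by
    rw [hγ.1.continuous_iff]
    have : γ ∘ e = δ := funext he
    rw [this]; exact δ.continuous
  have hei : Injective e := by
    intro a b hab
    apply hδ.1.injective
    rw [← he, ← he, hab]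
  obtain ⟨τ, hτ⟩ := hpK
  obtain ⟨θ, rfl⟩ := circ_surj hec hei τ
  obtain ⟨x, rfl⟩ := QuotientAddGroup.mk_surjective θ
  rw [he, ] at hτ
  have h1 := (hδ' x).symm.trans hτ
  obtain ⟨k, hk⟩ := pr_eq_iff.1 h1.symm
  have hper : Periodic ψ 1 := hp
  have := hper.int_mul k x
  rw [hk]
  simpa using this.symm

end CS

namespace CS

lemma rec_ann {f g : Ann → Ann} (hf : MeasurePreserving f volume volume) (cf : Continuous f)
    (cg : Continuous g) (gf : ∀ z, g (f z) = z)
    (hbd : ∀ z, ∃ k : ℕ, ∀ n, |(f^[n] z).2| ≤ k ∧ |(g^[n] z).2| ≤ k)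
    {O : Set Ann} (hO : IsOpen O) (hne : O.Nonempty) : ∃ z ∈ O, ∃ m ≠ 0, f^[m] z ∈ O := by
  set E : ℕ → Set Ann := fun k => {z | ∀ n, |(f^[n] z).2| ≤ k ∧ |(g^[n] z).2| ≤ k} with hE
  have hEc : ∀ k, IsClosed (E k) := by
    intro k
    have : E k = ⋂ n, ({z | |(f^[n] z).2| ≤ k} ∩ {z | |(g^[n] z).2| ≤ k}) := by
      ext z
      simp only [hE, mem_ofPred_eq, mem_iInter, mem_inter_iff]
    rw [this]
    exact isClosed_iInter fun n =>
      (isClosed_le (cf.iterate n).snd.abs continuous_const).inter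
        (isClosed_le (cg.iterate n).snd.abs continuous_const)
  have hEi : ∀ k, f ⁻¹' E k = E k := by
    intro k
    ext z
    constructor
    · intro h n
      refine ⟨?_, ?_⟩
      · cases n with
        | zero => have := (h 1).2; simpa [gf] using this
        | succ n => exact (h n).1
      · have := (h (n + 1)).2
        rwa [iterate_succ_apply, gf] at this
    · intro h n
      refine ⟨(h (n + 1)).1, ?_⟩
      cases n with
      | zero => exact (h 1).1
      | succ n => rw [iterate_succ_apply, gf]; exact (h n).2
  have hfin : ∀ k, volume (E k) < ⊤ := by
    intro k
    have hsub : E k ⊆ univ ×ˢ Icc (-(k:ℝ)) k := by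
      intro z hz
      exact ⟨trivial, abs_le.1 (hz 0).1⟩
    refine (measure_mono hsub).trans_lt ?_
    exact (isCompact_univ.prod isCompact_Icc).measure_lt_top
  have hpos : ∃ k, volume (O ∩ E k) ≠ 0 := by
    by_contra hcon
    push Not at hcon
    have h1 : O = ⋃ k, (O ∩ E k) := by
      rw [← inter_iUnion]
      refine (inter_eq_left.2 fun z _ => ?_).symm
      obtain ⟨k, hk⟩ := hbd z
      exact mem_iUnion.2 ⟨k, hk⟩
    have h2 : volume O = 0 := by
      rw [h1]
      exact measure_iUnion_null hcon
    exact (hO.measure_pos volume hne).ne' h2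
  obtain ⟨k, hk⟩ := hpos
  have hmp := hf.restrict_preimage (hEc k).measurableSet
  rw [hEi] at hmp
  have : IsFiniteMeasure (volume.restrict (E k)) := ⟨by simpa using hfin k⟩
  exact hmp.exists_mem_iterate_mem hO.measurableSet.nullMeasurableSet
    (by rwa [Measure.restrict_apply hO.measurableSet])

lemma pr_per (p : Pl) (k : ℤ) : pr (p + ((k:ℝ), 0)) = pr p := pr_eq_iff.2 ⟨k, rfl⟩

lemma leaf_of_curve {f : Ann → Ann} {F : Pl → Pl} (hlift : ∀ p, pr (F p) = f (pr p))
    (hfi : Injective f) {γ : C(Ci, Ann)} (hγ : EssentialCurve γ)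
    (hinv : f '' range γ = range γ) : Leaf F (pr ⁻¹' range γ) := by
  have hcpt : IsCompact (range γ) := isCompact_range γ.continuous
  refine ⟨hcpt.isClosed.preimage cont_pr, ?_, ?_, ?_, ?_, ?_⟩
  · intro k p
    rw [mem_preimage, mem_preimage, pr_per]
  · intro p
    rw [mem_preimage, mem_preimage, hlift]
    constructor
    · intro h
      rw [← hinv] at h
      obtain ⟨z, hz, e⟩ := h
      rwa [← hfi e]
    · intro h
      rw [← hinv]
      exact ⟨_, h, rfl⟩
  · obtain ⟨B, hB⟩ := (hcpt.image (continuous_snd.abs)).bddAbove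
    exact ⟨B, fun p hp => hB ⟨_, hp, rfl⟩⟩
  · obtain ⟨p, hp⟩ := pr_surj (γ 0)
    exact ⟨p, 0, hp.symm⟩
  · intro w hw
    obtain ⟨g, d, hg, hgl, hd, hgd⟩ := lift_essential hγ
    obtain ⟨τ, hτ⟩ := hw
    obtain ⟨t0, rfl⟩ := QuotientAddGroup.mk_surjective τ
    have h1 : pr w = pr (g t0) := hτ.symm.trans (hgl t0).symm
    obtain ⟨k, hk⟩ := pr_eq_iff.1 h1
    have hN : ∀ n : ℕ, ∀ t, g (t + n) = g t + ((n:ℝ) * d, 0) := by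
      intro n
      induction n with
      | zero => intro t; simp
      | succ n ih =>
        intro t
        have : t + ((n + 1 : ℕ) : ℝ) = (t + n) + 1 := by push_cast; ring
        rw [this, hgd, ih]
        ext
        · simp; ring
        · simp
    have hN' : ∀ n : ℕ, ∀ t, g (t - n) = g t - ((n:ℝ) * d, 0) := by
      intro n t
      have := hN n (t - n)
      rw [sub_add_cancel] at this
      rw [this, add_sub_cancel_right]
    refine ⟨fun s => g (t0 + s) + ((k:ℝ), 0), by fun_prop, ?_, ?_, ?_⟩
    · intro s
      rw [mem_preimage, pr_per, hgl]
      exact ⟨_, rfl⟩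
    · simp [hk]
    · intro M
      obtain ⟨n, hn⟩ := exists_nat_ge M
      rcases lt_or_gt_of_ne hd with h | h
      · refine ⟨n, -(n * d), ?_, ?_⟩
        · have h' : (d:ℝ) ≤ -1 := by exact_mod_cast (by omega : d ≤ -1)
          have hn0 : (0:ℝ) ≤ n := Nat.cast_nonneg n
          push_cast
          nlinarith
        · simp only [hN, hk]
          ext
          · simp; ring
          · simp
      · refine ⟨-n, n * d, ?_, ?_⟩
        · have h' : (1:ℝ) ≤ d := by exact_mod_cast (by omega : 1 ≤ d)
          have hn0 : (0:ℝ) ≤ n := Nat.cast_nonneg n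
          push_cast
          nlinarith
        · simp only [← sub_eq_add_neg, hN', hk]
          ext
          · simp; ring
          · simp

namespace TM
variable {F G : Pl → Pl} {Y : ℝ → ℝ → ℝ} {Sg : Pl → ℝ} (T : TM F G Y Sg)
include T

/-- the annulus map induced by the inverse -/
lemma exists_inv {f : Ann → Ann} (hlift : ∀ p, pr (F p) = f (pr p)) :
    ∃ g : Ann → Ann, Continuous f ∧ Continuous g ∧ (∀ z, g (f z) = z) ∧ (∀ z, f (g z) = z) := by
  have hG : ∀ p, pr (G (surjInv pr_surj (pr p))) = pr (G p) := by
    intro p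
    obtain ⟨k, hk⟩ := pr_eq_iff.1 (surjInv_eq pr_surj (pr p))
    rw [hk, T.perGZ, pr_per]
  refine ⟨fun z => pr (G (surjInv pr_surj z)), ?_, ?_, ?_, ?_⟩
  · rw [← pr_open.continuous_comp_iff]
    have : f ∘ pr = pr ∘ F := funext fun p => (hlift p).symm
    rw [this]
    exact cont_pr.comp T.contF
  · rw [← pr_open.continuous_comp_iff]
    have : (fun z => pr (G (surjInv pr_surj z))) ∘ pr = pr ∘ G := funext hG
    rw [this]
    exact cont_pr.comp T.contG
  · intro z
    obtain ⟨p, rfl⟩ := pr_surj z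
    simp only
    rw [← hlift, hG, T.GF]
  · intro z
    obtain ⟨p, rfl⟩ := pr_surj z
    simp only
    rw [hG, ← hlift, T.FG]

lemma rec_of_integrable {f : Ann → Ann} (hlift : ∀ p, pr (F p) = f (pr p))
    (hf : MeasurePreserving f volume volume) (h : C0IntegrableOn f univ) : Rec F := by
  obtain ⟨g, cf, cg, gf, fg⟩ := T.exists_inv hlift
  obtain ⟨ι, γ, hγ, hcov, -⟩ := h
  have hiter : ∀ n p, pr (F^[n] p) = f^[n] (pr p) := by
    intro n p
    induction n with
    | zero => rfl
    | succ n ih => rw [iterate_succ_apply', iterate_succ_apply', hlift, ih]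
  have hbd : ∀ z, ∃ k : ℕ, ∀ n, |(f^[n] z).2| ≤ k ∧ |(g^[n] z).2| ≤ k := by
    intro z
    have hz : z ∈ ⋃ i, range (γ i) := by rw [hcov]; trivial
    obtain ⟨i, hi⟩ := mem_iUnion.1 hz
    have hinv := (hγ i).2
    obtain ⟨B, hB⟩ := ((isCompact_range (γ i).continuous).image (continuous_snd.abs)).bddAbove
    obtain ⟨k, hk⟩ := exists_nat_ge B
    have h1 : ∀ n, f^[n] z ∈ range (γ i) := by
      intro n
      induction n with
      | zero => exact hi
      | succ n ih => rw [iterate_succ_apply', ← hinv]; exact ⟨_, ih, rfl⟩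
    have h2 : ∀ n, g^[n] z ∈ range (γ i) := by
      intro n
      induction n with
      | zero => exact hi
      | succ n ih =>
        rw [← hinv] at ih
        obtain ⟨u, hu, e⟩ := ih
        rw [iterate_succ_apply', ← e, gf]; exact hu
    exact ⟨k, fun n => ⟨(hB ⟨_, h1 n, rfl⟩).trans hk, (hB ⟨_, h2 n, rfl⟩).trans hk⟩⟩
  intro O hO hne
  obtain ⟨z, ⟨p, hp, rfl⟩, m, hm, q, hq, hqe⟩ := rec_ann hf cf cg gf hbd
    (pr_open.isOpenMap O hO) (hne.image pr)
  rw [← hiter] at hqe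
  obtain ⟨k, hk⟩ := pr_eq_iff.1 hqe.symm
  exact ⟨p, hp, q, hq, m, Nat.one_le_iff_ne_zero.2 hm, k, hk⟩

lemma graphs_of_integrable {f : Ann → Ann} (hlift : ∀ p, pr (F p) = f (pr p))
    (hf : MeasurePreserving f volume volume) (h : C0IntegrableOn f univ) (p : Pl) :
    ∃ ψ g : ℝ → ℝ, StrictMono g ∧ Surjective g ∧ (∀ x, F (x, ψ x) = (g x, ψ (g x))) ∧
      p.2 = ψ p.1 := by
  have hrec := T.rec_of_integrable hlift hf h
  obtain ⟨g', cf, cg, gf, fg⟩ := T.exists_inv hlift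
  have hfi : Injective f := LeftInverse.injective gf
  obtain ⟨ι, γ, hγ, hcov, -⟩ := h
  have hz : pr p ∈ ⋃ i, range (γ i) := by rw [hcov]; trivial
  obtain ⟨i, hi⟩ := mem_iUnion.1 hz
  have L := leaf_of_curve hlift hfi (hγ i).1 (hγ i).2
  obtain ⟨ψ, hψc, hψp, hψ⟩ := T.top_graph L hrec
  have hfill := graph_fills (hγ i).1 hψc hψp hψ
  have hinv : ∀ x, F (x, ψ x) = ((F (x, ψ x)).1, ψ (F (x, ψ x)).1) := by
    intro x
    exact Prod.ext rfl (hfill _ ((L.inv _).2 (hψ x)))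
  have hgc : Continuous fun x => (F (x, ψ x)).1 :=
    (T.contF.comp (continuous_id.prodMk hψc)).fst
  have hgi : Injective fun x => (F (x, ψ x)).1 := by
    intro a b hab
    simp only at hab
    have : F (a, ψ a) = F (b, ψ b) := by rw [hinv a, hinv b, hab]
    have := congrArg G this
    rw [T.GF, T.GF] at this
    exact congrArg Prod.fst this
  have hZ : ∀ (k : ℤ) x, (F (x + k, ψ (x + k))).1 = (F (x, ψ x)).1 + k := by
    intro k x
    have e1 : ψ (x + k) = ψ x := by
      have hper : Periodic ψ 1 := hψp
      simpa using hper.int_mul k x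
    have e2 : ((x + k, ψ (x + k)) : Pl) = (x, ψ x) + ((k:ℝ), 0) := by
      rw [e1]; ext <;> simp
    rw [e2, T.perZ]
    simp
  have hgm : StrictMono fun x => (F (x, ψ x)).1 := by
    rcases hgc.strictMono_of_inj hgi with h | h
    · exact h
    · exfalso
      have h1 := h (by norm_num : (0:ℝ) < 0 + ((1:ℤ):ℝ))
      have h2 := hZ 1 0
      simp only at h1
      rw [h2] at h1
      push_cast at h1
      linarith
  have hgs : Surjective fun x => (F (x, ψ x)).1 := by
    intro y
    obtain ⟨k, hk⟩ := exists_int_gt (y - (F (0, ψ 0)).1)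
    obtain ⟨l, hl⟩ := exists_int_lt (y - (F (0, ψ 0)).1)
    have h1 := hZ k 0
    have h2 := hZ l 0
    exact mem_range_of_exists_le_of_exists_ge hgc ⟨0 + l, by rw [h2]; linarith⟩
      ⟨0 + k, by rw [h1]; linarith⟩
  exact ⟨ψ, _, hgm, hgs, hinv, hfill p hi⟩

lemma noConj_of_graphs (h : ∀ p : Pl, ∃ ψ g : ℝ → ℝ, StrictMono g ∧ Surjective g ∧
      (∀ x, F (x, ψ x) = (g x, ψ (g x))) ∧ p.2 = ψ p.1) (p : Pl) (n : ℕ) (hn : 1 ≤ n) :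
    aa F n p ≠ 0 := by
  have hnn : ∀ n p, 0 ≤ aa F n p := by
    intro n p
    have hm : Monotone fun y => (F^[n] (p.1, y)).1 := by
      intro y1 y2 hy
      rcases hy.lt_or_eq with hlt | rfl
      · obtain ⟨ψ, g, hgm, hgs, hinv, hp⟩ := h (p.1, y1)
        simp only at hp ⊢
        have h1 := (T.above_iter hgm hgs hinv (p := (p.1, y2)) (by simpa [← hp] using hlt) n).1
        have h2 := T.iter_graph hinv n p.1
        rw [← hp] at h2
        rw [h2]
        exact h1
      · exact le_rfl
    have := (T.hasDerivAt_iter1 n p.1 p.2)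
    rw [← this.deriv]
    exact hm.deriv_nonneg
  intro h0
  obtain ⟨m, rfl⟩ : ∃ m, n = 1 + m := ⟨n - 1, by omega⟩
  have d1 := T.det_iter (1 + m) p
  have a1 := T.aa_add 1 (1 + m) p
  have p1 := hnn (1 + (1 + m)) p
  have q1 := T.aa_one_pos (F^[1 + m] p)
  rw [h0] at d1 a1
  rw [a1] at p1
  have hb0 : 0 ≤ bb F (1 + m) p := by
    by_contra hcon
    push Not at hcon
    nlinarith
  have hb : 0 < bb F (1 + m) p := by
    rcases hb0.lt_or_eq with h | h
    · exact h
    · rw [← h] at d1; norm_num at d1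
  have a2 := T.aa_add 1 m p
  have b2 := T.bb_add 1 m p
  have d2 := T.det_iter 1 (F^[m] p)
  have q2 := T.aa_one_pos (F^[m] p)
  rw [h0] at a2
  have : aa F m p = - (aa F 1 (F^[m] p) * bb F (1 + m) p) := by
    rw [b2]
    linear_combination (-aa F m p) * d2 - bb F 1 (F^[m] p) * a2
  have h3 := hnn m p
  have := mul_pos q2 hb
  linarith

end TM

lemma exists_TM (S : IsotopySetup) (htwist : S.PosTwist) (hexact : S.ExactSymplectic) :
    ∃ G Y Sg, TM S.F G Y Sg := by
  have h1 : (1:ℝ) ∈ Icc (0:ℝ) 1 := ⟨zero_le_one, le_rfl⟩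
  obtain ⟨G, cG, hl, hr⟩ := S.Ft_diffeo 1 h1
  obtain ⟨-, Sg, cS, perS, dS⟩ := hexact
  choose Y hY using fun x => (htwist x).2.1
  have cF : ContDiff ℝ 1 S.F := S.Ft_smooth 1 h1
  refine ⟨G, Y, Sg, cF, cG, hl, hr, S.Ft_periodic 1, fun x => (htwist x).1, ?_, hY, cS, perS, dS⟩
  intro p
  have h3 : HasDerivAt (fun y : ℝ => ((p.1, y) : Pl)) (0, 1) p.2 :=
    (hasDerivAt_const p.2 p.1).prodMk (hasDerivAt_id p.2)
  have h4 : HasFDerivAt S.F (fderiv ℝ S.F p) (p.1, p.2) :=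
    (cF.differentiable (by simp) p).hasFDerivAt
  have h5 : HasDerivAt (fun y => (S.F (p.1, y)).1) (fderiv ℝ S.F p (0, 1)).1 p.2 :=
    (ContinuousLinearMap.fst ℝ ℝ ℝ).hasFDerivAt.comp_hasDerivAt p.2 (h4.comp_hasDerivAt p.2 h3)
  rw [← h5.deriv]
  exact (htwist p.1).2.2 p.2

lemma main (S : IsotopySetup) (htwist : S.PosTwist) (hexact : S.ExactSymplectic) :
    C0IntegrableOn S.f (univ : Set Ann) ↔ S.NoConjPts := by
  obtain ⟨G, Y, Sg, T⟩ := exists_TM S htwist hexact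
  constructor
  · intro h p n hn
    exact T.noConj_of_graphs (T.graphs_of_integrable S.lift_f hexact.1 h) p n hn
  · intro h
    exact integrable_of_foliation S.lift_f T.FG (T.foliation h)

end CS

/-- **Cheng–Sun.** An exact symplectic positive twist map is `C⁰`-integrable
(the annulus is a disjoint union of `f`-invariant essential curves) if and only if it has no
conjugate points, i.e. for every `z ∈ ℝ²` and `n ≥ 1` the first component of `DFⁿ(z)(0,1)`
is nonzero. -/
theorem statement2 (S : IsotopySetup) (htwist : S.PosTwist)
    (hexact : S.ExactSymplectic) :
    C0IntegrableOn S.f (univ : Set Ann) ↔ S.NoConjPts := by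
  exact CS.main S htwist hexact

end
end
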